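/- arXiv:q-alg/9506021 — 2 statements merged into one kernel-verified Lean document; each statement's English description precedes it below -/
import Mathlib

section
/- Fix an integer r ≥ 2. The set of r-reduced Schur functions {S^(r)_λ(t) : λ a partition whose r-quotient has 0-th component λ[0] equal to the empty partition} is a basis of the ℚ-vector space P^(r). -/
open scoped BigOperators Classical

namespace RSF

/-! ### Partitions -/

/-- A partition, encoded as its (0-indexed, weakly decreasing, eventually zero)
sequence of parts: `f (j-1) = λ_j`. -/
def IsPartition (f : ℕ → ℕ) : Prop :=
  (∀ i j : ℕ, i ≤ j → f j ≤ f i) ∧ ∃ N : ℕ, ∀ i : ℕ, N ≤ i → f i = 0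

/-- The size `|λ|` of a partition. -/
noncomputable def psize (f : ℕ → ℕ) : ℕ := ∑ᶠ i, f i

/-- The number of (nonzero) parts of a partition. -/
noncomputable def plen (f : ℕ → ℕ) : ℕ := sInf {N : ℕ | ∀ i : ℕ, N ≤ i → f i = 0}

/-- The empty partition. -/
def emptyPart : ℕ → ℕ := fun _ => 0

/-- The transpose (conjugate) partition: `λ'_i = #{j : λ_j ≥ i}` (0-indexed). -/
noncomputable def transposeP (f : ℕ → ℕ) : ℕ → ℕ := fun i => Nat.card {j : ℕ // i < f j}

/-! ### Symmetric functions, Schur functions, Littlewood-Richardson coefficients -/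

/-- The ring of symmetric functions `Λ = ℚ[p_1, p_2, …]`; the variable `m` stands for the
power sum `p_{m+1}`. -/
abbrev SymmAlg : Type := MvPolynomial ℕ ℚ

/-- The power sum `p_j ∈ Λ` (for `j ≥ 1`). -/
noncomputable def pwr (j : ℕ) : SymmAlg := MvPolynomial.X (j - 1)

/-- Evaluation `ev_n : Λ → ℚ[x_1,…,x_n]`, sending `p_j` to `x_1^j + ⋯ + x_n^j`. -/
noncomputable def ev (n : ℕ) : SymmAlg →ₐ[ℚ] MvPolynomial (Fin n) ℚ :=
  MvPolynomial.aeval fun j => ∑ i : Fin n, MvPolynomial.X i ^ (j + 1)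

/-- The matrix `(x_i^{λ_j + n - j})_{1 ≤ i,j ≤ n}` (0-indexed). -/
noncomputable def schurMat (f : ℕ → ℕ) (n : ℕ) :
    Matrix (Fin n) (Fin n) (MvPolynomial (Fin n) ℚ) :=
  Matrix.of fun i j => MvPolynomial.X i ^ (f (j : ℕ) + (n - 1 - (j : ℕ)))

/-- `S` is the family of Schur functions: for every partition `λ` and every `n` at least the
number of parts of `λ`, `ev_n (S_λ) = det(x_i^{λ_j+n-j}) / det(x_i^{n-j})`.
(This determines `S_λ` uniquely.) -/
def IsSchurFamily (S : (ℕ → ℕ) → SymmAlg) : Prop :=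
  ∀ f : ℕ → ℕ, IsPartition f → ∀ n : ℕ, plen f ≤ n →
    ev n (S f) * (schurMat emptyPart n).det = (schurMat f n).det

/-- `LR` is the family of (multi-factor) Littlewood–Richardson coefficients of the Schur
family `S`: `S_{μ_1} ⋯ S_{μ_m} = Σ_λ LR^λ_{μ_1⋯μ_m} S_λ`. -/
def IsLRFamily (S : (ℕ → ℕ) → SymmAlg) (LR : (ℕ → ℕ) → List (ℕ → ℕ) → ℚ) : Prop :=
  (∀ lam L, ¬ IsPartition lam → LR lam L = 0) ∧
  (∀ lam L, LR lam L ≠ 0 → psize lam = (L.map psize).sum) ∧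
  (∀ L : List (ℕ → ℕ), (∀ g ∈ L, IsPartition g) →
    (L.map S).prod = ∑ᶠ lam : ℕ → ℕ, LR lam L • S lam)

/-- The ring `P^(r) = ℚ[t_j : j ≥ 1, r ∤ j]`. -/
abbrev PR (r : ℕ) : Type := MvPolynomial {j : ℕ // 0 < j ∧ ¬ r ∣ j} ℚ

/-- The homomorphism `ρ^(r) : Λ → P^(r)`, `p_j ↦ j·t_j` if `r ∤ j`, `p_j ↦ 0` if `r ∣ j`. -/
noncomputable def rho (r : ℕ) : SymmAlg →ₐ[ℚ] PR r :=
  MvPolynomial.aeval fun m =>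
    if h : r ∣ (m + 1) then 0
    else ((m + 1 : ℕ) : ℚ) • MvPolynomial.X ⟨m + 1, Nat.succ_pos m, h⟩

/-! ### Beta-sets, cores, quotients, and the `r`-sign -/

/-- The beta-set `{λ_i + N - i : 1 ≤ i ≤ N}` of a partition (first-`N` beta numbers);
it is the set of nonnegative entries of the representative of the corresponding Maya
diagram whose negative entries are exactly `{-1, -2, -3, …}` and which has `N`
nonnegative entries. -/
def betaFinset (f : ℕ → ℕ) (N : ℕ) : Finset ℕ :=
  (Finset.range N).image fun i => f i + (N - 1 - i)

/-- The elements of a finite set of naturals, listed in decreasing order. -/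
def descSort (s : Finset ℕ) : List ℕ := (s.sort (· ≤ ·)).reverse

/-- The partition whose beta-set (with `s.card` beta numbers) is `s`:
`λ_j = b_j - (card - j)` where `b_1 > b_2 > ⋯` are the elements of `s`. -/
def partOfBeta (s : Finset ℕ) : ℕ → ℕ :=
  fun j => (descSort s).getD j 0 - (s.card - 1 - j)

/-- A canonical choice of `N`: a multiple of `r` which is at least the number of parts.
(The constructions below are independent of this choice.) -/
noncomputable def defaultN (r : ℕ) (f : ℕ → ℕ) : ℕ := r * (plen f + 1)

/-- The `k`-th component `λ[k]` of the `r`-quotient of a partition. -/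
noncomputable def quotP (r : ℕ) (f : ℕ → ℕ) (k : ℕ) : ℕ → ℕ :=
  partOfBeta (((betaFinset f (defaultN r f)).filter fun b => b % r = k).image
    fun b => (b - k) / r)

/-- The `r`-core `λ_c` of a partition. -/
noncomputable def coreP (r : ℕ) (f : ℕ → ℕ) : ℕ → ℕ :=
  partOfBeta ((Finset.range r).biUnion fun k =>
    (Finset.range (((betaFinset f (defaultN r f)).filter fun b => b % r = k).card)).image
      fun j => j * r + k)

/-- The interleaved reading of the nonnegative entries: for `j = 1, 2, …` and
`k = 0, …, r-1`, the `j`-th largest beta number congruent to `k` mod `r` (if it exists). -/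
def interleaveAt (r N : ℕ) (f : ℕ → ℕ) : List ℕ :=
  (List.range N).flatMap fun j =>
    (List.range r).filterMap fun k =>
      (descSort ((betaFinset f N).filter fun b => b % r = k))[j]?

/-- The number of inversions of a list of naturals with respect to decreasing order. -/
def invCount (L : List ℕ) : ℕ :=
  ((Finset.range L.length ×ˢ Finset.range L.length).filter fun pq =>
    pq.1 < pq.2 ∧ L.getD pq.1 0 < L.getD pq.2 0).card

/-- The sign of the permutation sorting the interleaved reading of the nonnegative
entries of the chosen representative into decreasing order. -/
def deltaSignAt (r N : ℕ) (f : ℕ → ℕ) : ℤ := (-1) ^ invCount (interleaveAt r N f)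

/-- The `r`-sign `δ_r(λ)`: the sign of the permutation sorting the interleaved reading of
the nonnegative entries into decreasing order.  (It is normalized relative to the `r`-core,
so as to be independent of the choice of representative; on `r`-cores it is `+1`.) -/
noncomputable def deltaSign (r : ℕ) (f : ℕ → ℕ) : ℤ :=
  deltaSignAt r (defaultN r f) f * deltaSignAt r (defaultN r f) (coreP r f)

/-! ### Generalized Maya diagrams -/

/-- A generalized Maya diagram (as a sequence): `α_{i+1} = α_i - 1` for all large `i`. -/
def IsMaya (a : ℕ → ℤ) : Prop := ∃ N : ℕ, ∀ i : ℕ, N ≤ i → a (i + 1) = a i - 1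

/-- A strictly decreasing sequence (member of `M_d`). -/
def StrictDec (a : ℕ → ℤ) : Prop := ∀ i j : ℕ, i < j → a j < a i

/-- The action of `S_n ⊆ S_∞` on sequences, permuting the first `n` entries. -/
def permAct {n : ℕ} (σ : Equiv.Perm (Fin n)) (a : ℕ → ℤ) : ℕ → ℤ :=
  fun i => if h : i < n then a ((σ⁻¹ ⟨i, h⟩ : Fin n) : ℕ) else a i

/-- `f = λ(a)` : the partition associated with a strictly decreasing Maya sequence,
`λ_j = a_j - a_n + (j - n)` for all sufficiently large `n`. -/
def MayaCorresponds (a : ℕ → ℤ) (f : ℕ → ℕ) : Prop :=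
  ∃ N : ℕ, ∀ n : ℕ, N ≤ n → ∀ j : ℕ, j ≤ n →
    (f j : ℤ) = a j - a n + (j : ℤ) - (n : ℤ)

/-- `α + c·ε_i` : increase the `i`-th entry by `c`. -/
def addAt (a : ℕ → ℤ) (i : ℕ) (c : ℤ) : ℕ → ℤ := Function.update a i (a i + c)

/-- `SM` extends the Schur family `S` to generalized Maya diagrams:
`S_α = sgn(σ)·S_{λ(σα)}` when `σα` is strictly decreasing, and `S_α = 0` when `α` has
two equal entries. -/
def IsMayaSchur (S : (ℕ → ℕ) → SymmAlg) (SM : (ℕ → ℤ) → SymmAlg) : Prop :=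
  (∀ a : ℕ → ℤ, IsMaya a → (∃ i j : ℕ, i ≠ j ∧ a i = a j) → SM a = 0) ∧
  (∀ a : ℕ → ℤ, IsMaya a → ∀ (n : ℕ) (σ : Equiv.Perm (Fin n)) (f : ℕ → ℕ),
    StrictDec (permAct σ a) → MayaCorresponds (permAct σ a) f →
    SM a = ((Equiv.Perm.sign σ : ℤ) : ℚ) • S f)

/-- The `k`-th piece `α[k]` of the `r`-quotient of a Maya sequence (in its canonical
representative): the subsequence of entries congruent to `k` mod `r`, with
`α^{(k)}_i ↦ (α^{(k)}_i - k)/r`. -/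
noncomputable def mayaQuot (r : ℕ) (b : ℕ → ℤ) (k : ℕ) : ℕ → ℤ :=
  fun i => (b (Nat.nth (fun m => b m % (r : ℤ) = (k : ℤ)) i) - (k : ℤ)) / (r : ℤ)

/-! ### The space `U` -/

/-- Maya sequences. -/
def MSeq : Type := {a : ℕ → ℤ // IsMaya a}

/-- Two Maya sequences are equivalent iff they differ by a constant. -/
def mayaSetoid : Setoid MSeq where
  r a b := ∃ c : ℤ, ∀ i : ℕ, a.1 i = b.1 i + c
  iseqv := by
    refine ⟨fun a => ⟨0, fun i => by ring⟩, ?_, ?_⟩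
    · rintro a b ⟨c, h⟩
      exact ⟨-c, fun i => by have := h i; omega⟩
    · rintro a b c ⟨x, h⟩ ⟨y, h'⟩
      exact ⟨x + y, fun i => by have := h i; have := h' i; omega⟩

/-- The set `M` of generalized Maya diagrams. -/
def MayaCl : Type := Quotient mayaSetoid

/-- Permuting the first `n` entries preserves Maya sequences. -/
def permActM {n : ℕ} (σ : Equiv.Perm (Fin n)) (a : MSeq) : MSeq :=
  ⟨permAct σ a.1, by
    obtain ⟨N, hN⟩ := a.2
    refine ⟨max N n, fun i hi => ?_⟩
    have h1 : ¬ i < n := by omega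
    have h2 : ¬ i + 1 < n := by omega
    simp only [permAct, dif_neg h1, dif_neg h2]
    exact hN i (le_trans (le_max_left _ _) hi)⟩

/-- `α + c·ε_i` as a Maya sequence. -/
def addAtM (a : MSeq) (i : ℕ) (c : ℤ) : MSeq :=
  ⟨addAt a.1 i c, by
    obtain ⟨N, hN⟩ := a.2
    refine ⟨max N (i + 1), fun m hm => ?_⟩
    have h1 : m ≠ i := by omega
    have h2 : m + 1 ≠ i := by omega
    simp only [addAt, Function.update_apply, if_neg h1, if_neg h2]
    exact hN m (le_trans (le_max_left _ _) hm)⟩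

/-- The ℚ-vector space with basis `{u_α : α ∈ M}`. -/
abbrev FreeM : Type := MayaCl →₀ ℚ

/-- The vectors `u_{σα} - sgn(σ)·u_α`. -/
def relSet : Set FreeM :=
  {v | ∃ (a : MSeq) (n : ℕ) (σ : Equiv.Perm (Fin n)),
    v = Finsupp.single (Quotient.mk mayaSetoid (permActM σ a)) 1
      - ((Equiv.Perm.sign σ : ℤ) : ℚ) • Finsupp.single (Quotient.mk mayaSetoid a) 1}

/-- The space `U`. -/
abbrev Usp : Type := FreeM ⧸ Submodule.span ℚ relSet

/-- The image of `u_α` in `U`. -/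
noncomputable def uCl (α : MayaCl) : Usp :=
  Submodule.Quotient.mk (Finsupp.single α 1)

/-! ### Skew diagrams and rim hooks -/

/-- The cells of the skew diagram `μ/λ` (0-indexed rows and columns). -/
def cells (f g : ℕ → ℕ) : Set (ℕ × ℕ) := {c | f c.1 ≤ c.2 ∧ c.2 < g c.1}

/-- Two cells are adjacent iff they share an edge. -/
def adjCell (c d : ℕ × ℕ) : Prop :=
  (c.1 = d.1 ∧ (c.2 = d.2 + 1 ∨ d.2 = c.2 + 1)) ∨
  (c.2 = d.2 ∧ (c.1 = d.1 + 1 ∨ d.1 = c.1 + 1))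

/-- A set of cells is edgewise connected. -/
def ConnectedCells (s : Set (ℕ × ℕ)) : Prop :=
  ∀ c ∈ s, ∀ d ∈ s, Relation.ReflTransGen (fun x y => x ∈ s ∧ y ∈ s ∧ adjCell x y) c d

/-- No 2×2 block of cells. -/
def No2x2 (s : Set (ℕ × ℕ)) : Prop :=
  ¬ ∃ i j : ℕ, (i, j) ∈ s ∧ (i + 1, j) ∈ s ∧ (i, j + 1) ∈ s ∧ (i + 1, j + 1) ∈ s

/-- `μ/λ` is an `r`-hook (rim hook of length `r`). -/
def IsRHook (r : ℕ) (f g : ℕ → ℕ) : Prop :=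
  psize g = psize f + r ∧ ConnectedCells (cells f g) ∧ No2x2 (cells f g)

/-! ### Alternants -/

open MvPolynomial in
/-- The alternant `∑_σ sgn(σ) x^{b∘σ}`. -/
noncomputable def alternant {ι : Type*} [Fintype ι] [DecidableEq ι] (b : ι → ℕ) :
    MvPolynomial ι ℚ :=
  ∑ σ : Equiv.Perm ι,
    monomial (Finsupp.equivFunOnFinite.symm (b ∘ σ)) ((Equiv.Perm.sign σ : ℤ) : ℚ)

section Alternant

open MvPolynomial Equiv.Perm

variable {ι κ : Type*} [Fintype ι] [DecidableEq ι] [Fintype κ] [DecidableEq κ]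

lemma det_eq_alternant (b : ι → ℕ) :
    (Matrix.of fun i j => (X i : MvPolynomial ι ℚ) ^ b j).det = alternant b := by
  rw [Matrix.det_apply, alternant, ← Equiv.sum_comp (Equiv.inv (Equiv.Perm ι))]
  refine Finset.sum_congr rfl fun σ _ => ?_
  have h : ∏ i, (X (σ⁻¹ i) : MvPolynomial ι ℚ) ^ b i = ∏ i, X i ^ b (σ i) := by
    rw [← Equiv.prod_comp σ]; simp
  simp only [Equiv.inv_apply, Matrix.of_apply, sign_inv, h]
  rw [monomial_eq, Finsupp.prod_fintype _ _ (by simp), Units.smul_def, zsmul_eq_mul]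
  simp

lemma coeff_alternant (b : ι → ℕ) (m : ι →₀ ℕ) :
    coeff m (alternant b) =
      ∑ σ : Equiv.Perm ι, if b ∘ σ = m then ((sign σ : ℤ) : ℚ) else 0 := by
  simp only [alternant, coeff_sum, coeff_monomial]
  refine Finset.sum_congr rfl fun σ _ => ?_
  congr 1
  rw [Equiv.symm_apply_eq]; rfl

lemma exists_perm_of_coeff_alternant_ne_zero {b : ι → ℕ} {m : ι →₀ ℕ}
    (h : coeff m (alternant b) ≠ 0) : ∃ σ : Equiv.Perm ι, b ∘ σ = m := by
  rw [coeff_alternant] at h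
  obtain ⟨σ, -, hσ⟩ := Finset.exists_ne_zero_of_sum_ne_zero h
  exact ⟨σ, by by_contra h'; simp [h'] at hσ⟩

lemma coeff_alternant_self {b : ι → ℕ} (hb : Function.Injective b) {m : ι →₀ ℕ}
    (hm : b = m) : coeff m (alternant b) = 1 := by
  rw [coeff_alternant, Finset.sum_eq_single 1]
  · simp [hm]
  · intro σ _ hσ
    rw [if_neg]
    intro h
    apply hσ
    ext i
    exact hb (by rw [← hm] at h; exact congrFun h i)
  · simp

lemma rename_alternant (e : ι ≃ κ) (b : ι → ℕ) :
    rename e (alternant b) = alternant (b ∘ e.symm) := by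
  simp only [alternant, map_sum, rename_monomial]
  refine Fintype.sum_equiv e.permCongr _ _ fun σ => ?_
  rw [sign_permCongr]
  refine congrArg (fun m => monomial m _) (Finsupp.ext fun i => ?_)
  rw [← e.apply_symm_apply i, Finsupp.mapDomain_apply e.injective]
  simp

lemma alternant_comp (b : ι → ℕ) (τ : Equiv.Perm ι) :
    alternant (b ∘ τ) = ((sign τ : ℤ) : ℚ) • alternant b := by
  simp only [alternant, Finset.smul_sum, smul_monomial]
  refine Fintype.sum_equiv (Equiv.mulLeft τ) _ _ fun σ => ?_
  simp only [Equiv.coe_mulLeft, Equiv.Perm.sign_mul, smul_eq_mul]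
  have : ((sign τ : ℤ) : ℚ) * (((sign τ * sign σ : ℤˣ) : ℤ) : ℚ) = ((sign σ : ℤ) : ℚ) := by
    rcases Int.units_eq_one_or (sign τ) with h | h <;> simp [h]
  rw [this]; rfl

lemma rename_perm_alternant (τ : Equiv.Perm ι) (b : ι → ℕ) :
    rename τ (alternant b) = ((sign τ : ℤ) : ℚ) • alternant b := by
  rw [rename_alternant]
  have := alternant_comp b τ⁻¹
  rw [sign_inv] at this
  exact this

lemma alternant_eq_zero {b : ι → ℕ} (hb : ¬ Function.Injective b) : alternant b = 0 := by
  simp only [Function.Injective, not_forall] at hb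
  obtain ⟨i, j, h, hij⟩ := hb
  have h1 := alternant_comp b (Equiv.swap i j)
  have h2 : b ∘ Equiv.swap i j = b := by
    ext k
    simp only [Function.comp, Equiv.swap_apply_def]
    split_ifs with h1 h2 <;> simp_all
  rw [h2, sign_swap hij] at h1
  have h3 : (2 : ℚ) • alternant b = 0 := by
    rw [two_smul]; nth_rw 2 [h1]; simp
  exact (smul_eq_zero.mp h3).resolve_left (by norm_num)

/-- Polynomials transforming by the sign under permutations of the variables. -/
def IsAlternating (A : MvPolynomial ι ℚ) : Prop :=
  ∀ τ : Equiv.Perm ι, rename τ A = ((sign τ : ℤ) : ℚ) • A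

lemma IsAlternating.coeff_comp {A : MvPolynomial ι ℚ} (hA : IsAlternating A)
    (τ : Equiv.Perm ι) {m n : ι →₀ ℕ} (h : (n : ι → ℕ) = m ∘ τ) :
    coeff n A = ((sign τ : ℤ) : ℚ) * coeff m A := by
  have h1 : Finsupp.mapDomain τ n = m := by
    ext i
    rw [← τ.apply_symm_apply i, Finsupp.mapDomain_apply τ.injective, h]
    simp
  rw [← coeff_rename_mapDomain τ τ.injective A n, h1, hA τ, coeff_smul, smul_eq_mul]

lemma IsAlternating.mem_span {A : MvPolynomial ι ℚ} (hA : IsAlternating A) :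
    A ∈ Submodule.span ℚ {B | ∃ m ∈ A.support, Function.Injective m ∧ B = alternant m} := by
  have h : ((Fintype.card (Equiv.Perm ι) : ℕ) : ℚ) • A =
      ∑ m ∈ A.support, coeff m A • alternant m := by
    have h1 : ∀ τ : Equiv.Perm ι, A = ∑ m ∈ A.support, coeff m A •
        monomial (Finsupp.equivFunOnFinite.symm (m ∘ τ)) ((sign τ : ℤ) : ℚ) := by
      intro τ
      have h2 := hA τ⁻¹
      have h3 : A = ((sign τ : ℤ) : ℚ) • rename (τ⁻¹ : Equiv.Perm ι) A := by
        rw [h2, smul_smul, sign_inv]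
        rcases Int.units_eq_one_or (sign τ) with h | h <;> simp [h]
      conv_lhs => rw [h3, A.as_sum]
      rw [map_sum, Finset.smul_sum]
      refine Finset.sum_congr rfl fun m _ => ?_
      rw [rename_monomial, smul_monomial, smul_monomial, smul_eq_mul, smul_eq_mul, mul_comm]
      refine congrArg (fun m => monomial m _) (Finsupp.ext fun i => ?_)
      rw [← Equiv.apply_symm_apply τ⁻¹ i, Finsupp.mapDomain_apply (Equiv.injective _)]
      simp
      rfl
    have h4 : ∑ τ : Equiv.Perm ι, A = ∑ m ∈ A.support, coeff m A • alternant m := by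
      rw [Finset.sum_congr rfl fun τ _ => h1 τ, Finset.sum_comm]
      simp only [alternant, Finset.smul_sum]
    rw [← h4]; simp [Nat.cast_smul_eq_nsmul]
  have h5 : A = ((Fintype.card (Equiv.Perm ι) : ℕ) : ℚ)⁻¹ •
      ∑ m ∈ A.support, coeff m A • alternant m := by
    rw [← h, smul_smul, inv_mul_cancel₀ (by exact_mod_cast Fintype.card_ne_zero), one_smul]
  suffices h6 : ((Fintype.card (Equiv.Perm ι) : ℕ) : ℚ)⁻¹ •
      ∑ m ∈ A.support, coeff m A • alternant m ∈ Submodule.span ℚ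
        {B | ∃ m ∈ A.support, Function.Injective m ∧ B = alternant m} by
    rwa [← h5] at h6
  refine Submodule.smul_mem _ _ (Submodule.sum_mem _ fun m hm => Submodule.smul_mem _ _ ?_)
  by_cases hi : Function.Injective m
  · exact Submodule.subset_span ⟨m, hm, hi, rfl⟩
  · rw [alternant_eq_zero hi]; exact Submodule.zero_mem _

end Alternant

/-! ### Evaluation in finitely many variables -/

section Evaluation

open MvPolynomial

variable {ι κ : Type*} [Fintype ι] [Fintype κ]

/-- Evaluation of symmetric functions in the variables indexed by a finite type. -/
noncomputable def evOn (ι : Type*) [Fintype ι] : SymmAlg →ₐ[ℚ] MvPolynomial ι ℚ :=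
  aeval fun j => ∑ i : ι, X i ^ (j + 1)

lemma ev_eq_evOn (n : ℕ) : ev n = evOn (Fin n) := rfl

lemma rename_evOn (e : ι ≃ κ) (F : SymmAlg) : rename e (evOn ι F) = evOn κ F := by
  rw [← AlgHom.comp_apply]
  congr 1
  ext1 j
  simp only [evOn, AlgHom.comp_apply, aeval_X, map_sum, map_pow, rename_X]
  exact Equiv.sum_comp e fun i => (X i : MvPolynomial κ ℚ) ^ (j + 1)

lemma killCompl_evOn (p : ι → Prop) [Fintype {i // p i}] (F : SymmAlg) :
    killCompl (R := ℚ) (Subtype.val_injective (p := p)) (evOn ι F) = evOn {i // p i} F := by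
  rw [← AlgHom.comp_apply]
  congr 1
  ext1 j
  have hX : ∀ i : {i // p i}, killCompl (R := ℚ) (Subtype.val_injective (p := p))
      (X (i : ι)) = X i := fun i => by
    rw [← rename_X, killCompl_rename_app]
  have hX' : ∀ i : ι, ¬ p i → killCompl (R := ℚ) (Subtype.val_injective (p := p)) (X i) = 0 :=
    fun i hi => by
      rw [killCompl, aeval_X, dif_neg]
      rintro ⟨k, rfl⟩
      exact hi k.2
  simp only [evOn, AlgHom.comp_apply, aeval_X, map_sum, map_pow]
  rw [← Fintype.sum_subtype_add_sum_subtype p]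
  have h0 : ∑ i : {i // ¬ p i}, killCompl (R := ℚ) (Subtype.val_injective (p := p))
      (X (i : ι)) ^ (j + 1) = 0 :=
    Finset.sum_eq_zero fun i _ => by rw [hX' i.1 i.2, zero_pow j.succ_ne_zero]
  rw [h0, add_zero]
  exact Finset.sum_congr (by ext; simp) fun i _ => by rw [hX i]

lemma coeff_evOn_subtype (p : ι → Prop) [Fintype {i // p i}] (F : SymmAlg)
    {m : ι →₀ ℕ} (hm : ∀ i, ¬ p i → m i = 0) :
    coeff m (evOn ι F) =
      coeff (Finsupp.equivFunOnFinite.symm fun i : {i // p i} => m i) (evOn {i // p i} F) := by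
  rw [← killCompl_evOn p F, coeff_killCompl]
  congr 1
  ext i
  by_cases hi : p i
  · rw [show i = ((⟨i, hi⟩ : {i // p i}) : ι) from rfl,
      Finsupp.mapDomain_apply Subtype.val_injective]
    simp
  · rw [hm i hi, Finsupp.mapDomain_of_notMem_range]
    rintro ⟨k, rfl⟩
    exact hi k.2

/-- The plethysm `p_j ↦ p_{rj}`. -/
noncomputable def plethysm (r : ℕ) : SymmAlg →ₐ[ℚ] SymmAlg :=
  aeval fun j => X (r * (j + 1) - 1)

lemma evOn_plethysm {r : ℕ} (hr : 0 < r) (F : SymmAlg) :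
    evOn ι (plethysm r F) = expand r (evOn ι F) := by
  rw [← AlgHom.comp_apply, ← AlgHom.comp_apply]
  congr 1
  ext1 j
  have : r * (j + 1) - 1 + 1 = r * (j + 1) := Nat.sub_add_cancel (Nat.mul_pos hr j.succ_pos)
  simp [plethysm, evOn, AlgHom.comp_apply, this, pow_mul]

lemma injective_of_surjective_ringEnd {R : Type*} [CommRing R] [IsNoetherianRing R]
    (f : R →+* R) (hf : Function.Surjective f) : Function.Injective f := by
  let K : ℕ →o Ideal R := ⟨fun n => RingHom.ker (f ^ n), monotone_nat_of_le_succ fun n x hx => by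
    rw [RingHom.mem_ker] at hx ⊢
    rw [pow_succ', RingHom.mul_def, RingHom.comp_apply, hx, map_zero]⟩
  obtain ⟨n, hn⟩ := monotone_stabilizes_iff_noetherian.mpr ‹IsNoetherianRing R› K
  rw [injective_iff_map_eq_zero]
  intro x hx
  have hs : Function.Surjective (f ^ n) := by
    rw [RingHom.coe_pow]; exact hf.iterate n
  obtain ⟨y, rfl⟩ := hs x
  have hy : y ∈ K (n + 1) := by
    change (f ^ (n + 1)) y = 0
    rw [pow_succ', RingHom.mul_def, RingHom.comp_apply, hx]
  rw [← hn (n + 1) n.le_succ] at hy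
  exact hy

lemma esymm_mem_adjoin_psum (n k : ℕ) (hk : k ≤ n) :
    esymm (Fin n) ℚ k ∈ Algebra.adjoin ℚ (Set.range fun j : Fin n => psum (Fin n) ℚ (j + 1)) := by
  induction k using Nat.strong_induction_on with
  | _ k ih =>
    rcases Nat.eq_zero_or_pos k with rfl | hpos
    · simp
    have h := mul_esymm_eq_sum (Fin n) ℚ k
    have h2 : esymm (Fin n) ℚ k = (k : ℚ)⁻¹ • ((k : MvPolynomial (Fin n) ℚ) * esymm _ ℚ k) := by
      rw [← nsmul_eq_mul, ← Nat.cast_smul_eq_nsmul ℚ, smul_smul,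
        inv_mul_cancel₀ (by exact_mod_cast hpos.ne'), one_smul]
    rw [h2, h]
    have hneg : ∀ a : ℕ, (-1 : MvPolynomial (Fin n) ℚ) ^ a ∈
        Algebra.adjoin ℚ (Set.range fun j : Fin n => psum (Fin n) ℚ (j + 1)) := fun a =>
      pow_mem (neg_mem (one_mem _)) a
    refine Subalgebra.smul_mem _ (mul_mem (hneg _) (sum_mem fun a ha => ?_)) _
    rw [Finset.mem_filter, Finset.HasAntidiagonal.mem_antidiagonal] at ha
    refine mul_mem (mul_mem (hneg _) (ih _ ha.2 (by omega))) (Algebra.subset_adjoin ?_)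
    exact ⟨⟨a.2 - 1, by omega⟩, by simp only; congr 1; omega⟩

lemma aeval_psum_injective (n : ℕ) :
    Function.Injective (aeval (R := ℚ) fun j : Fin n => psum (Fin n) ℚ (j + 1)) := by
  let g : MvPolynomial (Fin n) ℚ →ₐ[ℚ] symmetricSubalgebra (Fin n) ℚ :=
    aeval fun j : Fin n => ⟨psum (Fin n) ℚ (j + 1), psum_isSymmetric _ _ _⟩
  have hg : ∀ p, (g p : MvPolynomial (Fin n) ℚ) =
      aeval (fun j : Fin n => psum (Fin n) ℚ (j + 1)) p := fun p =>
    (Subalgebra.mvPolynomial_aeval_coe _ _ _).symm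
  have hgs : Function.Surjective g := by
    intro q
    obtain ⟨p, rfl⟩ := (esymmAlgHom_fin_bijective (R := ℚ) n).2 q
    have hp : ((esymmAlgHom (Fin n) ℚ n p : symmetricSubalgebra (Fin n) ℚ) :
        MvPolynomial (Fin n) ℚ) ∈
          Algebra.adjoin ℚ (Set.range fun j : Fin n => psum (Fin n) ℚ (j + 1)) := by
      rw [esymmAlgHom_apply]
      have h1 : aeval (fun i : Fin n => esymm (Fin n) ℚ (i + 1)) p ∈
          Algebra.adjoin ℚ (Set.range fun i : Fin n => esymm (Fin n) ℚ (i + 1)) := by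
        rw [Algebra.adjoin_range_eq_range_aeval]; exact ⟨p, rfl⟩
      refine Algebra.adjoin_le ?_ h1
      rintro _ ⟨i, rfl⟩
      exact esymm_mem_adjoin_psum n _ i.2
    rw [Algebra.adjoin_range_eq_range_aeval] at hp
    obtain ⟨p', hp'⟩ := hp
    exact ⟨p', Subtype.ext (by rw [hg]; exact hp')⟩
  let E := esymmAlgEquiv (R := ℚ) (σ := Fin n) (Fintype.card_fin n)
  have hf : Function.Injective (E.symm ∘ g) :=
    injective_of_surjective_ringEnd
      (E.symm.toAlgHom.toRingHom.comp g.toRingHom)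
      (E.symm.surjective.comp hgs)
  intro p q hpq
  rw [← hg, ← hg] at hpq
  exact hf (congrArg E.symm (Subtype.ext hpq))

lemma eq_zero_of_ev_eq_zero {n : ℕ} {F : SymmAlg} (hF : F ∈ supported ℚ {j : ℕ | j < n})
    (h : ev n F = 0) : F = 0 := by
  rw [supported_eq_range_rename] at hF
  obtain ⟨G, rfl⟩ := hF
  obtain ⟨G, rfl⟩ := (rename_surjective (R := ℚ) (fun j : Fin n => (⟨j, j.2⟩ : {j : ℕ | j < n}))
    fun j => ⟨⟨j.1, j.2⟩, rfl⟩) G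
  have h1 : G = 0 := by
    apply aeval_psum_injective n
    rw [map_zero, ← h]
    simp only [ev, AlgHom.toRingHom_eq_coe, RingHom.coe_coe, rename_rename, aeval_rename]
    rfl
  rw [h1]; simp

lemma exists_ev_injective (s : Finset SymmAlg) :
    ∃ n₀, ∀ n, n₀ ≤ n → ∀ F ∈ Submodule.span ℚ (s : Set SymmAlg), ev n F = 0 → F = 0 := by
  refine ⟨s.sup (fun F => F.vars.sup id) + 1, fun n hn F hF h => eq_zero_of_ev_eq_zero ?_ h⟩
  have : Submodule.span ℚ (s : Set SymmAlg) ≤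
      Subalgebra.toSubmodule (supported ℚ {j : ℕ | j < n}) := by
    rw [Submodule.span_le]
    intro F hF
    rw [SetLike.mem_coe, Subalgebra.mem_toSubmodule, mem_supported]
    intro j hj
    have h1 : j ≤ F.vars.sup id := Finset.le_sup (f := id) hj
    have h2 : F.vars.sup id ≤ s.sup (fun F => F.vars.sup id) :=
      Finset.le_sup (f := fun F : SymmAlg => F.vars.sup id) hF
    exact Set.mem_ofPred.mpr (by omega)
  exact this hF

end Evaluation

/-! ### Beta numbers of partitions -/

/-- The beta numbers of a partition, listed in decreasing order. -/
def beta (f : ℕ → ℕ) (N : ℕ) : Fin N → ℕ := fun j => f j + (N - 1 - j)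

lemma isPartition_emptyPart : IsPartition emptyPart := ⟨fun _ _ _ => le_rfl, 0, fun _ _ => rfl⟩

lemma plen_le_iff {f : ℕ → ℕ} (hf : IsPartition f) {n : ℕ} :
    plen f ≤ n ↔ ∀ i, n ≤ i → f i = 0 := by
  refine ⟨fun h i hi => ?_, fun h => Nat.sInf_le h⟩
  exact Nat.sInf_mem (s := {N : ℕ | ∀ i : ℕ, N ≤ i → f i = 0}) hf.2 i (h.trans hi)

lemma plen_emptyPart : plen emptyPart = 0 :=
  Nat.le_zero.mp ((plen_le_iff isPartition_emptyPart).2 fun _ _ => rfl)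

lemma psize_eq_sum {f : ℕ → ℕ} (hf : IsPartition f) {n : ℕ} (hn : plen f ≤ n) :
    psize f = ∑ i : Fin n, f i := by
  rw [psize, finsum_eq_sum_of_support_subset (s := Finset.range n), Finset.sum_range]
  intro i hi
  by_contra h
  exact hi ((plen_le_iff hf).1 hn i (by simpa using h))

lemma sum_beta {f : ℕ → ℕ} (hf : IsPartition f) {n : ℕ} (hn : plen f ≤ n) :
    ∑ i, beta f n i = psize f + ∑ i, beta emptyPart n i := by
  simp [beta, emptyPart, psize_eq_sum hf hn, Finset.sum_add_distrib]

lemma plen_le_psize {f : ℕ → ℕ} (hf : IsPartition f) : plen f ≤ psize f := by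
  have h : ∀ i ∈ Finset.range (plen f), 1 ≤ f i := by
    intro i hi
    rw [Finset.mem_range] at hi
    by_contra h
    have h0 : plen f ≤ i := (plen_le_iff hf).2 fun j hj => by have := hf.1 i j hj; omega
    omega
  rw [psize_eq_sum hf le_rfl, ← Finset.sum_range (fun i => f i)]
  simpa using Finset.sum_le_sum h

lemma psize_eq_zero {f : ℕ → ℕ} (hf : IsPartition f) (h : psize f = 0) : f = emptyPart := by
  have h1 := plen_le_psize hf
  ext i
  exact (plen_le_iff hf).1 (h1.trans h.le) i (Nat.zero_le i)

lemma finite_partitions (D : ℕ) : {f : ℕ → ℕ | IsPartition f ∧ psize f ≤ D}.Finite := by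
  refine Set.Finite.of_finite_image (f := fun f (i : Fin D) => f i) ?_ ?_
  · refine (Set.Finite.pi (t := fun _ : Fin D => Set.Iic D) fun _ => Set.finite_Iic D).subset ?_
    rintro _ ⟨f, ⟨hf, hD⟩, rfl⟩ i -
    rw [psize_eq_sum hf ((plen_le_psize hf).trans hD)] at hD
    exact (Finset.single_le_sum (f := fun i : Fin D => f i) (fun _ _ => Nat.zero_le _)
      (Finset.mem_univ i)).trans hD
  · rintro f ⟨hf, hfD⟩ g ⟨hg, hgD⟩ h
    ext i
    by_cases hi : i < D
    · exact congrFun h ⟨i, hi⟩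
    · rw [(plen_le_iff hf).1 ((plen_le_psize hf).trans hfD) i (by omega),
        (plen_le_iff hg).1 ((plen_le_psize hg).trans hgD) i (by omega)]

lemma beta_strictAnti {f : ℕ → ℕ} (hf : IsPartition f) (n : ℕ) : StrictAnti (beta f n) := by
  intro i j hij
  have := hf.1 i j hij.le
  have : (i : ℕ) < j := hij
  simp only [beta]
  omega

lemma beta_injective {f : ℕ → ℕ} (hf : IsPartition f) (n : ℕ) : Function.Injective (beta f n) :=
  (beta_strictAnti hf n).injective

lemma eq_of_beta_eq {f g : ℕ → ℕ} (hf : IsPartition f) (hg : IsPartition g) {n : ℕ}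
    (hfn : plen f ≤ n) (hgn : plen g ≤ n) (h : beta f n = beta g n) : f = g := by
  ext i
  by_cases hi : i < n
  · have := congrFun h ⟨i, hi⟩
    simpa [beta] using this
  · rw [(plen_le_iff hf).1 hfn i (by omega), (plen_le_iff hg).1 hgn i (by omega)]

lemma eq_of_range_beta_eq {f g : ℕ → ℕ} (hf : IsPartition f) (hg : IsPartition g) {n : ℕ}
    (hfn : plen f ≤ n) (hgn : plen g ≤ n) (h : Set.range (beta f n) = Set.range (beta g n)) :
    f = g := by
  refine eq_of_beta_eq hf hg hfn hgn ?_
  have h1 : ∀ k, IsPartition k → StrictMono (beta k n ∘ Fin.rev) := fun k hk i j hij =>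
    beta_strictAnti hk n (Fin.rev_lt_rev.2 hij)
  have h2 : ∀ k : Fin n → ℕ, Set.range (k ∘ Fin.rev) = Set.range k := fun k =>
    Fin.rev_surjective.range_comp k
  have h3 := ((h1 f hf).range_inj (h1 g hg)).1 (by rw [h2, h2, h])
  ext i
  simpa using congrFun h3 i.rev

lemma add_sub_le_of_strictAnti {n : ℕ} {b : Fin n → ℕ} (hb : StrictAnti b) (i j : Fin n)
    (hij : i ≤ j) : b j + (j - i : ℕ) ≤ b i := by
  obtain ⟨j, hj⟩ := j
  induction j with
  | zero => 
    have : i = ⟨0, hj⟩ := le_antisymm hij (Fin.mk_le_of_le_val (Nat.zero_le _))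
    subst this; simp
  | succ j ih =>
    rcases hij.eq_or_lt with rfl | h
    · simp
    · have h1 := ih (by omega) (Fin.mk_le_mk.2 (Nat.lt_succ_iff.1 h))
      have h2 : b ⟨j + 1, hj⟩ < b ⟨j, by omega⟩ := hb (Fin.mk_lt_mk.2 j.lt_succ_self)
      have h3 : (i : ℕ) < j + 1 := h
      simp only at h1 ⊢
      omega

lemma exists_partition_of_strictAnti {n : ℕ} {b : Fin n → ℕ} (hb : StrictAnti b) :
    ∃ f, IsPartition f ∧ plen f ≤ n ∧ beta f n = b := by
  have hf : IsPartition fun i => if h : i < n then b ⟨i, h⟩ - (n - 1 - i) else 0 := by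
    refine ⟨fun i j hij => ?_, n, fun i hi => dif_neg (by omega)⟩
    by_cases hj : j < n
    · have h := add_sub_le_of_strictAnti hb ⟨i, by omega⟩ ⟨j, hj⟩ hij
      simp only [hj, show i < n by omega, dif_pos] at h ⊢
      omega
    · simp [hj]
  refine ⟨_, hf, (plen_le_iff hf).2 fun i hi => dif_neg (by omega), ?_⟩
  ext ⟨i, hi⟩
  have h := add_sub_le_of_strictAnti hb ⟨i, hi⟩ ⟨n - 1, by omega⟩
    (Fin.mk_le_mk.2 (by omega))
  simp only [beta, hi, dif_pos] at h ⊢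
  omega

lemma exists_perm_strictAnti {n : ℕ} {b : Fin n → ℕ} (hb : Function.Injective b) :
    ∃ τ : Equiv.Perm (Fin n), StrictAnti (b ∘ τ) := by
  refine ⟨Fin.revPerm.trans (Tuple.sort b), ?_⟩
  have h : StrictMono (b ∘ Tuple.sort b) :=
    (Tuple.monotone_sort b).strictMono_of_injective (hb.comp (Equiv.injective _))
  intro i j hij
  exact h (Fin.rev_lt_rev.2 hij)

lemma exists_partition_of_injective {n : ℕ} {b : Fin n → ℕ} (hb : Function.Injective b) :
    ∃ (τ : Equiv.Perm (Fin n)) (f : ℕ → ℕ), IsPartition f ∧ plen f ≤ n ∧ beta f n = b ∘ τ := by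
  obtain ⟨τ, hτ⟩ := exists_perm_strictAnti hb
  exact ⟨τ, exists_partition_of_strictAnti hτ⟩

/-! ### Schur functions -/

section Schur

open MvPolynomial

variable {S : (ℕ → ℕ) → SymmAlg}

lemma ev_schur_mul (hS : IsSchurFamily S) {f : ℕ → ℕ} (hf : IsPartition f) {n : ℕ}
    (hn : plen f ≤ n) :
    ev n (S f) * alternant (beta emptyPart n) = alternant (beta f n) := by
  have h := hS f hf n hn
  have h1 : ∀ g, (schurMat g n).det = alternant (beta g n) := fun g => det_eq_alternant (beta g n)
  rwa [h1, h1] at h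

lemma alternant_ne_zero {ι : Type*} [Fintype ι] [DecidableEq ι] {b : ι → ℕ}
    (hb : Function.Injective b) : alternant b ≠ 0 := by
  intro h
  have := coeff_alternant_self hb (m := Finsupp.equivFunOnFinite.symm b) rfl
  simp [h] at this

lemma alternant_delta_ne_zero (n : ℕ) : alternant (beta emptyPart n) ≠ 0 :=
  alternant_ne_zero (beta_injective isPartition_emptyPart n)

lemma isHomogeneous_alternant {ι : Type*} [Fintype ι] [DecidableEq ι] (b : ι → ℕ) :
    (alternant b).IsHomogeneous (∑ i, b i) := by
  refine IsHomogeneous.sum _ _ _ fun σ _ => isHomogeneous_monomial _ ?_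
  rw [Finsupp.degree_eq_sum]
  exact Equiv.sum_comp σ b

lemma totalDegree_alternant {ι : Type*} [Fintype ι] [DecidableEq ι] {b : ι → ℕ}
    (hb : Function.Injective b) : (alternant b).totalDegree = ∑ i, b i :=
  (isHomogeneous_alternant b).totalDegree (alternant_ne_zero hb)

lemma ev_schur_ne_zero (hS : IsSchurFamily S) {f : ℕ → ℕ} (hf : IsPartition f) {n : ℕ}
    (hn : plen f ≤ n) : ev n (S f) ≠ 0 := by
  intro h
  have := ev_schur_mul hS hf hn
  rw [h, zero_mul] at this
  exact alternant_ne_zero (beta_injective hf n) this.symm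

lemma totalDegree_ev_schur (hS : IsSchurFamily S) {f : ℕ → ℕ} (hf : IsPartition f) {n : ℕ}
    (hn : plen f ≤ n) : (ev n (S f)).totalDegree = psize f := by
  have h := congrArg totalDegree (ev_schur_mul hS hf hn)
  rw [totalDegree_mul_of_isDomain (ev_schur_ne_zero hS hf hn) (alternant_delta_ne_zero n),
    totalDegree_alternant (beta_injective hf n),
    totalDegree_alternant (beta_injective isPartition_emptyPart n), sum_beta hf hn] at h
  omega

lemma constantCoeff_ev (n : ℕ) (F : SymmAlg) : constantCoeff (ev n F) = constantCoeff F := by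
  have : ((constantCoeff (σ := Fin n) (R := ℚ)).comp (ev n : SymmAlg →+* _)) = constantCoeff := by
    ext j
    · simp
    · simp [ev]
  exact congrArg (fun g => g F) this

lemma constantCoeff_schur (hS : IsSchurFamily S) {f : ℕ → ℕ} (hf : IsPartition f)
    (hne : f ≠ emptyPart) : constantCoeff (S f) = 0 := by
  have hn : plen f ≤ plen f := le_rfl
  set d : Fin (plen f) →₀ ℕ := Finsupp.equivFunOnFinite.symm (beta emptyPart (plen f)) with hd
  have h := congrArg (coeff d) (ev_schur_mul hS hf hn)
  have h0 : coeff d (alternant (beta f (plen f))) = 0 := by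
    by_contra h1
    obtain ⟨σ, hσ⟩ := exists_perm_of_coeff_alternant_ne_zero h1
    have h2 := sum_beta hf hn
    have h3 := Equiv.sum_comp σ (beta f (plen f))
    have h4 : ∑ i, beta f (plen f) (σ i) = ∑ i, beta emptyPart (plen f) i :=
      Finset.sum_congr rfl fun i _ => congrFun hσ i
    exact hne (psize_eq_zero hf (by omega))
  rw [h0, coeff_mul, Finset.sum_eq_single (0, d)] at h
  · rw [coeff_alternant_self (beta_injective isPartition_emptyPart _) rfl, mul_one] at h
    rw [← constantCoeff_ev (plen f)]
    exact h
  · rintro ⟨x, y⟩ hxy hne'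
    rw [Finset.HasAntidiagonal.mem_antidiagonal] at hxy
    simp only at hxy ⊢
    by_contra h1
    obtain ⟨σ, hσ⟩ := exists_perm_of_coeff_alternant_ne_zero (right_ne_zero_of_mul h1)
    have h3 := Equiv.sum_comp σ (beta emptyPart (plen f))
    have h4 : ∑ i, beta emptyPart (plen f) (σ i) = ∑ i, y i :=
      Finset.sum_congr rfl fun i _ => congrFun hσ i
    have h5 : ∑ i, x i + ∑ i, y i = ∑ i, beta emptyPart (plen f) i := by
      rw [← Finset.sum_add_distrib]
      exact Finset.sum_congr rfl fun i _ => DFunLike.congr_fun hxy i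
    have h6 : x = 0 := by
      ext i
      exact (Finset.sum_eq_zero_iff.1 (show ∑ i, x i = 0 by omega)) i (Finset.mem_univ i)
    exact hne' (by rw [← hxy, h6, zero_add])
  · simp

lemma schur_emptyPart (hS : IsSchurFamily S) : S emptyPart = 1 := by
  obtain ⟨n₀, hn⟩ := exists_ev_injective {S emptyPart - 1}
  rw [← sub_eq_zero]
  refine hn n₀ le_rfl _ (Submodule.subset_span (by simp)) ?_
  have h := ev_schur_mul hS isPartition_emptyPart (n := n₀) (by simp [plen_emptyPart])
  rw [map_sub, map_one, sub_eq_zero]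
  exact mul_right_cancel₀ (alternant_delta_ne_zero n₀) (by rw [h, one_mul])

lemma mem_span_of_frequently_ev_mul {s : Set SymmAlg} (hs : s.Finite) {F : SymmAlg}
    (h : ∀ n₀, ∃ n, n₀ ≤ n ∧ ev n F * alternant (beta emptyPart n) ∈
      Submodule.span ℚ ((fun G => ev n G * alternant (beta emptyPart n)) '' s)) :
    F ∈ Submodule.span ℚ s := by
  obtain ⟨n₀, hn₀⟩ := exists_ev_injective (insert F hs.toFinset)
  obtain ⟨n, hn, hmem⟩ := h n₀
  have h1 : (fun G => ev n G * alternant (beta emptyPart n)) =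
      ((LinearMap.mulRight ℚ (alternant (beta emptyPart n))).comp (ev n).toLinearMap :
        SymmAlg →ₗ[ℚ] _) := rfl
  rw [h1, Submodule.span_image] at hmem
  obtain ⟨G, hG, hGF⟩ := hmem
  have h2 : ev n (F - G) = 0 := by
    rw [map_sub, sub_eq_zero]
    exact (mul_right_cancel₀ (alternant_delta_ne_zero n) hGF).symm
  have hle : Submodule.span ℚ s ≤ Submodule.span ℚ ((insert F hs.toFinset : Finset SymmAlg) :
      Set SymmAlg) := Submodule.span_mono fun x hx => by simp [hx]
  have h3 := hn₀ n hn (F - G) (Submodule.sub_mem _ (Submodule.subset_span (by simp)) (hle hG)) h2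
  rw [sub_eq_zero.mp h3]
  exact hG

lemma isAlternating_alternant {ι : Type*} [Fintype ι] [DecidableEq ι] (b : ι → ℕ) :
    IsAlternating (alternant b) := fun τ => rename_perm_alternant τ b

lemma IsAlternating.evOn_mul {ι : Type*} [Fintype ι] [DecidableEq ι] {A : MvPolynomial ι ℚ}
    (hA : IsAlternating A) (F : SymmAlg) : IsAlternating (evOn ι F * A) := fun τ => by
  rw [map_mul, rename_evOn, hA τ, mul_smul_comm]

lemma IsAlternating.sub {ι : Type*} [Fintype ι] [DecidableEq ι] {A B : MvPolynomial ι ℚ}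
    (hA : IsAlternating A) (hB : IsAlternating B) : IsAlternating (A - B) := fun τ => by
  rw [map_sub, hA τ, hB τ, smul_sub]

lemma exists_totalDegree_ev_le (F : SymmAlg) : ∃ D, ∀ n, (ev n F).totalDegree ≤ D := by
  induction F using MvPolynomial.induction_on with
  | C a => exact ⟨0, fun n => by simp [ev]⟩
  | add p q hp hq =>
    obtain ⟨D, hD⟩ := hp
    obtain ⟨E, hE⟩ := hq
    exact ⟨max D E, fun n => by
      rw [map_add]; exact (totalDegree_add _ _).trans (max_le_max (hD n) (hE n))⟩
  | mul_X p j hp =>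
    obtain ⟨D, hD⟩ := hp
    refine ⟨D + (j + 1), fun n => ?_⟩
    rw [map_mul]
    refine (totalDegree_mul _ _).trans (add_le_add (hD n) ?_)
    simp only [ev, aeval_X]
    refine totalDegree_finsetSum_le fun i _ => ?_
    simp

/-- Sorting an injective exponent turns an alternant into that of a partition, up to sign. -/
lemma exists_partition_alternant_mem {n : ℕ} {b : Fin n → ℕ} (hb : Function.Injective b) :
    ∃ f, IsPartition f ∧ plen f ≤ n ∧ Set.range (beta f n) = Set.range b ∧
      alternant b ∈ Submodule.span ℚ {alternant (beta f n)} := by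
  obtain ⟨τ, f, hf, hn, h⟩ := exists_partition_of_injective hb
  refine ⟨f, hf, hn, by rw [h, Set.range_comp, τ.range_eq_univ, Set.image_univ], ?_⟩
  have h2 : b = beta f n ∘ (τ⁻¹ : Equiv.Perm (Fin n)) := by
    rw [h]; ext i; simp
  rw [h2, alternant_comp]
  exact Submodule.smul_mem _ _ (Submodule.mem_span_singleton_self _)

lemma sum_eq_of_range_eq {n : ℕ} {b c : Fin n → ℕ} (hb : Function.Injective b)
    (hc : Function.Injective c) (h : Set.range b = Set.range c) (g : ℕ → ℕ) :
    ∑ i, g (b i) = ∑ i, g (c i) := by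
  have : Finset.univ.image b = Finset.univ.image c := by
    apply Finset.coe_injective; simpa using h
  rw [← Finset.sum_image (f := g) (g := b) (s := Finset.univ) (fun _ _ _ _ h => hb h), this,
    Finset.sum_image (fun _ _ _ _ h => hc h)]

lemma mem_span_schur (hS : IsSchurFamily S) (F : SymmAlg) :
    F ∈ Submodule.span ℚ (S '' {f | IsPartition f}) := by
  obtain ⟨D, hD⟩ := exists_totalDegree_ev_le F
  suffices h : F ∈ Submodule.span ℚ (S '' {f | IsPartition f ∧ psize f ≤ D}) from
    Submodule.span_mono (Set.image_mono fun f hf => hf.1) h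
  refine mem_span_of_frequently_ev_mul ((finite_partitions D).image S) fun n₀ =>
    ⟨max n₀ D, le_max_left _ _, ?_⟩
  have hDn := le_max_right n₀ D
  generalize max n₀ D = n at *
  have hA := (isAlternating_alternant (beta emptyPart n)).evOn_mul F
  refine Submodule.span_le.2 ?_ hA.mem_span
  rintro _ ⟨m, hm, hinj, rfl⟩
  obtain ⟨f, hf, hn, hr, hmem⟩ := exists_partition_alternant_mem hinj
  refine Submodule.span_mono ?_ hmem
  rw [Set.singleton_subset_iff, Set.image_image]
  refine ⟨f, ⟨hf, ?_⟩, ev_schur_mul hS hf hn⟩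
  have h1 : ∑ i, m i ≤ D + ∑ i, beta emptyPart n i := by
    have h2 := le_totalDegree hm
    rw [Finsupp.sum_fintype _ _ fun _ => rfl] at h2
    refine h2.trans ((totalDegree_mul _ _).trans (add_le_add (hD n) ?_))
    rw [totalDegree_alternant (beta_injective isPartition_emptyPart n)]
  have h3 := sum_beta hf hn
  have h4 := sum_eq_of_range_eq (beta_injective hf n) hinj hr id
  simp only [id] at h4
  omega

end Schur

/-! ### Leading coefficients of plethystic products -/

section Plethystic

open MvPolynomial

variable {ι : Type*} [Fintype ι]

lemma sum_subtype_add_sum_compl (p : ι → Prop) [DecidablePred p] (m : ι → ℕ) :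
    ∑ i : {i // p i}, m i + ∑ i : {i // ¬ p i}, m i = ∑ i, m i :=
  Fintype.sum_subtype_add_sum_subtype p m

/-- The sum of the multiples of `r` among the values of `b`. -/
def multSum (r : ℕ) (b : ι → ℕ) : ℕ := ∑ i, if r ∣ b i then b i else 0

lemma multSum_eq (r : ℕ) (b : ι → ℕ) : multSum r b = ∑ i : {i // r ∣ b i}, b i := by
  rw [multSum, ← Finset.sum_filter]
  exact (Finset.sum_subtype _ (by simp) _)

lemma multSum_comp (r : ℕ) (b : ι → ℕ) (τ : Equiv.Perm ι) : multSum r (b ∘ τ) = multSum r b :=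
  Equiv.sum_comp τ fun i => if r ∣ b i then b i else 0

variable {S : (ℕ → ℕ) → SymmAlg}

lemma totalDegree_evOn_schur_le (hS : IsSchurFamily S) {f : ℕ → ℕ} (hf : IsPartition f)
    (hn : plen f ≤ Fintype.card ι) : (evOn ι (S f)).totalDegree ≤ psize f := by
  rw [← rename_evOn (Fintype.equivFin ι).symm, ← ev_eq_evOn, ← totalDegree_ev_schur hS hf hn]
  exact totalDegree_rename_le _ _

/-- A nonzero contribution to a coefficient of `expand r H * alternant β`. -/
lemma exists_of_expand_term_ne_zero {r : ℕ} {H : MvPolynomial ι ℚ} {b s : ι →₀ ℕ}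
    {q : ℚ} (h : (if s ≤ b then coeff (b - s) (expand r H) * q else 0) ≠ 0) :
    ∃ m : ι →₀ ℕ, (∀ i, b i = s i + r * m i) ∧ ∑ i, m i ≤ H.totalDegree := by
  rw [ne_eq, ite_eq_right_iff, Classical.not_imp] at h
  obtain ⟨hle, h⟩ := h
  have h1 := left_ne_zero_of_mul h
  have h2 := mem_support_iff.2 h1
  obtain ⟨m, hm, hmb⟩ := Finset.mem_image.1 (support_expand_subset _ h2)
  refine ⟨m, fun i => ?_, ?_⟩
  · have h3 := DFunLike.congr_fun hmb i
    have h4 := hle i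
    simp only [Finsupp.smul_apply, smul_eq_mul, Finsupp.tsub_apply] at h3
    omega
  · have h5 := le_totalDegree hm
    rwa [Finsupp.sum_fintype _ _ fun _ => rfl] at h5

variable [DecidableEq ι]

lemma coeff_mul_alternant (A : MvPolynomial ι ℚ) (β : ι → ℕ) (b : ι →₀ ℕ) :
    coeff b (A * alternant β) = ∑ σ : Equiv.Perm ι,
      if Finsupp.equivFunOnFinite.symm (β ∘ σ) ≤ b then
        coeff (b - Finsupp.equivFunOnFinite.symm (β ∘ σ)) A *
          ((Equiv.Perm.sign σ : ℤ) : ℚ) else 0 := by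
  rw [alternant, Finset.mul_sum, coeff_sum]
  exact Finset.sum_congr rfl fun σ _ => coeff_mul_monomial' _ _ _ _

lemma coeff_expand_mul_alternant {r : ℕ} (hr : 0 < r) {β : ι → ℕ} (hβ : Function.Injective β)
    (F : SymmAlg) {D : ℕ} (hD : (evOn ι F).totalDegree ≤ D) {γ b' : {i // r ∣ β i} → ℕ}
    (hγ : ∀ i : {i // r ∣ β i}, β i = r * γ i) {b : ι →₀ ℕ} (hb : ∀ i, ¬ r ∣ β i → b i = β i)
    (hb' : ∀ i : {i // r ∣ β i}, b i = r * b' i)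
    (hsum : r * D + ∑ i : {i // r ∣ β i}, β i ≤ ∑ i : {i // r ∣ β i}, b i) :
    coeff b (expand r (evOn ι F) * alternant β) =
      coeff (Finsupp.equivFunOnFinite.symm b') (evOn {i // r ∣ β i} F * alternant γ) := by
  rw [coeff_mul_alternant, coeff_mul_alternant]
  symm
  refine Finset.sum_of_injOn (fun τ => Equiv.Perm.ofSubtype τ)
    (Equiv.Perm.ofSubtype_injective.injOn) (fun _ _ => Finset.mem_coe.2 (Finset.mem_univ _))
    (fun σ _ hσ => ?_) fun τ _ => ?_
  · by_contra h
    obtain ⟨m, hm, hmD⟩ := exists_of_expand_term_ne_zero h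
    simp only [Finsupp.coe_equivFunOnFinite_symm, Function.comp] at hm
    have hdvd : ∀ i, r ∣ β (σ i) ↔ r ∣ β i := by
      intro i
      rw [Nat.dvd_add_left (Dvd.intro (m i) rfl) |>.symm.trans (by rw [← hm i])]
      by_cases hi : r ∣ β i
      · simp [hi, hb' ⟨i, hi⟩]
      · rw [hb i hi]
    have h1 : ∑ i : {i // r ∣ β i}, β (σ i) = ∑ i : {i // r ∣ β i}, β i :=
      Equiv.sum_comp (σ.subtypePerm hdvd) fun i : {i // r ∣ β i} => β i
    have h2 : ∑ i : {i // r ∣ β i}, b i =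
        ∑ i : {i // r ∣ β i}, β i + r * ∑ i : {i // r ∣ β i}, m i := by
      rw [← h1, Finset.mul_sum, ← Finset.sum_add_distrib]
      exact Finset.sum_congr rfl fun i _ => hm i
    have h3 := sum_subtype_add_sum_compl (fun i => r ∣ β i) m
    have h4 : D ≤ ∑ i : {i // r ∣ β i}, m i := by
      have : r * D ≤ r * ∑ i : {i // r ∣ β i}, m i := by omega
      exact Nat.le_of_mul_le_mul_left this hr
    have h5 : ∑ i : {i // ¬ r ∣ β i}, m i = 0 := by omega
    have h6 : ∀ i, ¬ r ∣ β i → σ i = i := by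
      intro i hi
      have h7 := Finset.sum_eq_zero_iff.1 h5 ⟨i, hi⟩ (Finset.mem_univ _)
      have h8 := hm i
      simp only at h7
      rw [h7, mul_zero, add_zero, hb i hi] at h8
      exact (hβ h8).symm
    exact hσ ⟨σ.subtypePerm hdvd, Finset.mem_coe.2 (Finset.mem_univ _),
      Equiv.Perm.ofSubtype_subtypePerm hdvd fun i hi => by_contra fun h => hi (h6 i h)⟩
  · have hin : ∀ i : {i // r ∣ β i}, β (Equiv.Perm.ofSubtype τ i) = r * γ (τ i) := fun i => by
      rw [Equiv.Perm.ofSubtype_apply_coe, hγ]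
    have hout : ∀ i, ¬ r ∣ β i → β (Equiv.Perm.ofSubtype τ i) = β i := fun i hi => by
      rw [Equiv.Perm.ofSubtype_apply_of_not_mem (p := fun i => r ∣ β i) τ hi]
    have hle : Finsupp.equivFunOnFinite.symm (γ ∘ τ) ≤ Finsupp.equivFunOnFinite.symm b' ↔
        Finsupp.equivFunOnFinite.symm (β ∘ Equiv.Perm.ofSubtype τ) ≤ b := by
      simp only [Finsupp.le_def, Finsupp.coe_equivFunOnFinite_symm, Function.comp]
      constructor
      · intro h i
        by_cases hi : r ∣ β i
        · have h1 := hin ⟨i, hi⟩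
          have h2 := hb' ⟨i, hi⟩
          simp only at h1 h2
          rw [h1, h2]
          exact Nat.mul_le_mul_left r (h ⟨i, hi⟩)
        · rw [hout i hi, hb i hi]
      · intro h i
        have h1 := h i
        rw [hin i, hb' i] at h1
        exact Nat.le_of_mul_le_mul_left h1 hr
    simp only [hle, Equiv.Perm.sign_ofSubtype]
    split_ifs with h
    swap
    · rfl
    congr 1
    let m : ι →₀ ℕ := Finsupp.equivFunOnFinite.symm fun i =>
      if hi : r ∣ β i then b' ⟨i, hi⟩ - γ (τ ⟨i, hi⟩) else 0
    have hm : b - Finsupp.equivFunOnFinite.symm (β ∘ Equiv.Perm.ofSubtype τ) = r • m := by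
      ext i
      simp only [Finsupp.tsub_apply, Finsupp.smul_apply, smul_eq_mul, m,
        Finsupp.coe_equivFunOnFinite_symm, Function.comp]
      by_cases hi : r ∣ β i
      · have h1 := hin ⟨i, hi⟩
        have h2 := hb' ⟨i, hi⟩
        simp only at h1 h2
        rw [dif_pos hi, h1, h2, Nat.mul_sub]
      · rw [dif_neg hi, hout i hi, hb i hi]; simp
    rw [hm, coeff_expand_smul _ hr.ne', coeff_evOn_subtype (fun i => r ∣ β i) F (m := m)
      (fun i hi => by simp [m, hi])]
    congr 1
    ext i
    simp [m, i.2]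

lemma evOn_schur_mul (hS : IsSchurFamily S) {f : ℕ → ℕ} (hf : IsPartition f) {c : ℕ}
    (hc : plen f ≤ c) (e : Fin c ≃ ι) :
    evOn ι (S f) * alternant (beta emptyPart c ∘ e.symm) = alternant (beta f c ∘ e.symm) := by
  rw [← rename_evOn e, ← rename_alternant, ← rename_alternant, ← map_mul, ← ev_eq_evOn,
    ev_schur_mul hS hf hc]

lemma coeff_expand_schur_mul (hS : IsSchurFamily S) {r : ℕ} (hr : 0 < r) {β : ι → ℕ}
    (hβ : Function.Injective β) {c : ℕ} (e : Fin c ≃ {i // r ∣ β i})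
    (he : ∀ j, β (e j) = r * beta emptyPart c j) {f : ℕ → ℕ} (hf : IsPartition f)
    (hfc : plen f ≤ c) {b : ι →₀ ℕ} (hb : ∀ i, ¬ r ∣ β i → b i = β i)
    {b' : {i // r ∣ β i} → ℕ} (hb' : ∀ i : {i // r ∣ β i}, b i = r * b' i)
    (hsum : r * psize f + multSum r β ≤ multSum r b) :
    coeff b (expand r (evOn ι (S f)) * alternant β) =
      coeff (Finsupp.equivFunOnFinite.symm b') (alternant (beta f c ∘ e.symm)) := by
  have hcard : c ≤ Fintype.card ι := by
    rw [← Fintype.card_fin c, Fintype.card_congr e]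
    exact Fintype.card_subtype_le _
  have hdvd : ∀ i, r ∣ b i ↔ r ∣ β i := fun i => by
    by_cases hi : r ∣ β i
    · simp [hi, hb' ⟨i, hi⟩]
    · rw [hb i hi]
  have h1 : multSum r b = ∑ i : {i // r ∣ β i}, b i := by
    rw [multSum, ← Finset.sum_filter]
    exact (Finset.sum_subtype _ (by simp [hdvd]) _)
  rw [coeff_expand_mul_alternant hr hβ (S f)
    (totalDegree_evOn_schur_le hS hf (hfc.trans hcard)) (γ := beta emptyPart c ∘ e.symm)
    (fun i => by have := he (e.symm i); simpa using this) hb hb'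
    (by rwa [multSum_eq, h1] at hsum), evOn_schur_mul hS hf hfc]

lemma coeff_expand_schur_ne_zero (hS : IsSchurFamily S) {r : ℕ} (hr : 0 < r) {β : ι → ℕ}
    (hβ : Function.Injective β) {c : ℕ} (e : Fin c ≃ {i // r ∣ β i})
    (he : ∀ j, β (e j) = r * beta emptyPart c j) {f : ℕ → ℕ} (hf : IsPartition f)
    (hfc : plen f ≤ c) {b : ι →₀ ℕ}
    (h : coeff b (expand r (evOn ι (S f)) * alternant β) ≠ 0) :
    Nonempty (Fin c ≃ {i // r ∣ b i}) ∧ multSum r b ≤ r * psize f + multSum r β ∧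
      (r * psize f + multSum r β ≤ multSum r b →
        ∀ x, x ∈ Set.range b ↔ (x ∈ Set.range β ∧ ¬ r ∣ x) ∨ ∃ j, x = r * beta f c j) := by
  have hcard : c ≤ Fintype.card ι := by
    rw [← Fintype.card_fin c, Fintype.card_congr e]
    exact Fintype.card_subtype_le _
  obtain ⟨σ, m, hm, hmD⟩ : ∃ (σ : Equiv.Perm ι) (m : ι →₀ ℕ),
      (∀ i, b i = β (σ i) + r * m i) ∧ ∑ i, m i ≤ psize f := by
    rw [coeff_mul_alternant] at h
    obtain ⟨σ, -, hσ⟩ := Finset.exists_ne_zero_of_sum_ne_zero h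
    obtain ⟨m, hm, hmD⟩ := exists_of_expand_term_ne_zero hσ
    exact ⟨σ, m, hm, hmD.trans (totalDegree_evOn_schur_le hS hf (hfc.trans hcard))⟩
  set d : ι →₀ ℕ := Finsupp.equivFunOnFinite.symm (b ∘ (σ⁻¹ : Equiv.Perm ι)) with hd
  set n : ι → ℕ := m ∘ (σ⁻¹ : Equiv.Perm ι) with hn
  have hbd : (b : ι → ℕ) = d ∘ σ := by ext i; simp [hd]
  have hdn : ∀ i, d i = β i + r * n i := fun i => by simp [hd, hn, hm]
  have hnD : ∑ i, n i ≤ psize f := by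
    rw [hn]; exact (Equiv.sum_comp (σ⁻¹ : Equiv.Perm ι) m).trans_le hmD
  have hdvd : ∀ i, r ∣ d i ↔ r ∣ β i := fun i => by
    rw [hdn, Nat.dvd_add_left (Dvd.intro (n i) rfl)]
  have hM : multSum r b = multSum r d := by rw [hbd, multSum_comp]
  have hMd : multSum r d = multSum r β + r * ∑ i : {i // r ∣ β i}, n i := by
    rw [multSum_eq r β, multSum, ← Finset.sum_filter, Finset.mul_sum, ← Finset.sum_add_distrib,
      Finset.sum_subtype (p := fun i => r ∣ β i) _ (by simp [hdvd])]
    exact Finset.sum_congr rfl fun i _ => hdn i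
  have hsplit := sum_subtype_add_sum_compl (fun i => r ∣ β i) n
  refine ⟨⟨e.trans (σ.symm.subtypeEquiv fun i => ?_)⟩, ?_, fun hge => ?_⟩
  · rw [← hdvd, hbd]; simp
  · rw [hM, hMd, add_comm]
    exact Nat.add_le_add_right (Nat.mul_le_mul_left r (by omega)) _
  · have h4 : psize f ≤ ∑ i : {i // r ∣ β i}, n i := by
      have : r * psize f ≤ r * ∑ i : {i // r ∣ β i}, n i := by omega
      exact Nat.le_of_mul_le_mul_left this hr
    have h5 : ∑ i : {i // ¬ r ∣ β i}, n i = 0 := by omega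
    have hoff : ∀ i, ¬ r ∣ β i → d i = β i := fun i hi => by
      have h7 := Finset.sum_eq_zero_iff.1 h5 ⟨i, hi⟩ (Finset.mem_univ _)
      simp only at h7
      rw [hdn, h7, mul_zero, add_zero]
    have hon : ∀ i : {i // r ∣ β i}, d i = r * (d i / r) := fun i =>
      (Nat.mul_div_cancel' ((hdvd i).2 i.2)).symm
    have hA : IsAlternating (expand r (evOn ι (S f)) * alternant β) := by
      rw [← evOn_plethysm hr]
      exact (isAlternating_alternant β).evOn_mul _
    rw [hA.coeff_comp σ hbd] at h
    have h := right_ne_zero_of_mul h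
    rw [coeff_expand_schur_mul hS hr hβ e he hf hfc hoff hon (by omega)] at h
    obtain ⟨τ, hτ⟩ := exists_perm_of_coeff_alternant_ne_zero h
    have hτ' : ∀ i, beta f c (e.symm (τ i)) = d i / r := fun i => congrFun hτ i
    intro x
    have hr' : Set.range b = Set.range d := by rw [hbd, σ.surjective.range_comp]
    rw [hr']
    constructor
    · rintro ⟨i, rfl⟩
      by_cases hi : r ∣ β i
      · exact Or.inr ⟨e.symm (τ ⟨i, hi⟩), by rw [hτ']; exact hon ⟨i, hi⟩⟩
      · exact Or.inl ⟨⟨i, (hoff i hi).symm⟩, fun h => hi ((hdvd i).1 h)⟩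
    · rintro (⟨⟨i, rfl⟩, hi⟩ | ⟨j, rfl⟩)
      · exact ⟨i, hoff i hi⟩
      · refine ⟨τ.symm (e j), ?_⟩
        rw [hon, ← hτ']
        simp

end Plethystic

/-! ### The component `λ[0]` of the quotient -/

lemma coe_betaFinset (f : ℕ → ℕ) (N : ℕ) : (betaFinset f N : Set ℕ) = Set.range (beta f N) := by
  ext x
  simp only [betaFinset, Finset.coe_image, Finset.coe_range, Set.mem_image, Set.mem_Iio,
    Set.mem_range, beta]
  exact ⟨fun ⟨i, hi, h⟩ => ⟨⟨i, hi⟩, h⟩, fun ⟨i, h⟩ => ⟨i, i.2, h⟩⟩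

lemma mem_range_beta_add {f : ℕ → ℕ} (hf : IsPartition f) {N : ℕ} (hN : plen f ≤ N) (r x : ℕ) :
    x + r ∈ Set.range (beta f (N + r)) ↔ x ∈ Set.range (beta f N) := by
  constructor
  · rintro ⟨⟨i, hi⟩, h⟩
    simp only [beta] at h
    have hiN : i < N := by
      by_contra hc
      have := (plen_le_iff hf).1 hN i (by omega)
      omega
    exact ⟨⟨i, hiN⟩, by simp only [beta]; omega⟩
  · rintro ⟨⟨i, hi⟩, h⟩
    simp only [beta] at h
    exact ⟨⟨i, by omega⟩, by simp only [beta]; omega⟩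

lemma mem_range_beta_add_of_lt {f : ℕ → ℕ} (hf : IsPartition f) {N : ℕ} (hN : plen f ≤ N)
    {r x : ℕ} (hx : x < r) : x ∈ Set.range (beta f (N + r)) := by
  refine ⟨⟨N + r - 1 - x, by omega⟩, ?_⟩
  have := (plen_le_iff hf).1 hN (N + r - 1 - x) (by omega)
  simp only [beta, this]
  omega

/-- The multiples of `r` in `B` form an initial segment. -/
def MultClosed (r : ℕ) (B : Set ℕ) : Prop := ∀ x, r ∣ x → x + r ∈ B → x ∈ B

lemma multClosed_range_beta_add {f : ℕ → ℕ} (hf : IsPartition f) {N : ℕ} (hN : plen f ≤ N)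
    {r : ℕ} :
    MultClosed r (Set.range (beta f (N + r))) ↔ MultClosed r (Set.range (beta f N)) := by
  constructor
  · intro h x hx hxB
    rw [← mem_range_beta_add hf hN r] at hxB ⊢
    exact h _ (Dvd.dvd.add hx dvd_rfl) hxB
  · intro h x hx hxB
    rw [mem_range_beta_add hf hN r] at hxB
    rcases lt_or_ge x r with hlt | hge
    · exact mem_range_beta_add_of_lt hf hN hlt
    · obtain ⟨y, rfl⟩ := Nat.exists_eq_add_of_le' hge
      exact (mem_range_beta_add hf hN r y).2 (h y ((Nat.dvd_add_left dvd_rfl).1 hx) hxB)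

lemma multClosed_range_beta_congr {f : ℕ → ℕ} (hf : IsPartition f) {r : ℕ}
    {k l : ℕ} (hk : plen f ≤ r * k) (hl : plen f ≤ r * l) :
    MultClosed r (Set.range (beta f (r * k))) ↔ MultClosed r (Set.range (beta f (r * l))) := by
  have key : ∀ a b, a ≤ b → plen f ≤ r * a →
      (MultClosed r (Set.range (beta f (r * a))) ↔
        MultClosed r (Set.range (beta f (r * b)))) := by
    intro a b hab ha
    induction b, hab using Nat.le_induction with
    | base => rfl
    | succ b hab ih =>
      rw [ih, Nat.mul_succ, multClosed_range_beta_add hf (ha.trans (Nat.mul_le_mul_left r hab))]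
  rcases le_total k l with h | h
  · exact key k l h hk
  · exact (key l k h hl).symm

lemma partOfBeta_eq_emptyPart_iff (s : Finset ℕ) :
    partOfBeta s = emptyPart ↔ s = Finset.range s.card := by
  constructor
  · intro h
    refine Finset.eq_of_subset_of_card_le (fun x hx => ?_) (by simp)
    have hx' : x ∈ descSort s := by simpa [descSort] using hx
    obtain ⟨j, hj, hjx⟩ := List.mem_iff_getElem.1 hx'
    have h1 := congrFun h j
    have hlen : (descSort s).length = s.card := by simp [descSort]
    simp only [partOfBeta, emptyPart, List.getD_eq_getElem _ _ hj, hjx] at h1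
    rw [Finset.mem_range]
    omega
  · intro h
    ext j
    have hs : s.sort (· ≤ ·) = List.range s.card := by
      conv_lhs => rw [h]
      exact Finset.sort_range _
    simp only [partOfBeta, emptyPart, descSort, hs]
    by_cases hj : j < s.card
    · rw [List.getD_eq_getElem _ _ (by simpa using hj)]
      simp
    · rw [List.getD_eq_default _ _ (by simpa using hj)]
      simp

lemma eq_range_card_iff (s : Finset ℕ) : s = Finset.range s.card ↔ ∀ k, k + 1 ∈ s → k ∈ s := by
  constructor
  · intro h k hk
    rw [h, Finset.mem_range] at hk ⊢
    omega
  · intro h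
    have h1 : ∀ k ∈ s, ∀ j, j ≤ k → j ∈ s := by
      intro k hk j hj
      induction k, hj using Nat.le_induction with
      | base => exact hk
      | succ k hjk ih => exact ih (h k hk)
    refine Finset.eq_of_subset_of_card_le (fun k hk => ?_) (by simp)
    have h2 : Finset.range (k + 1) ⊆ s := fun j hj =>
      h1 k hk j (Nat.lt_succ_iff.1 (Finset.mem_range.1 hj))
    have := Finset.card_le_card h2
    rw [Finset.card_range] at this
    exact Finset.mem_range.2 this

lemma quotP_zero_eq_emptyPart_iff {f : ℕ → ℕ} (hf : IsPartition f) {r : ℕ} (hr : 0 < r) {k : ℕ}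
    (hk : plen f ≤ r * k) :
    quotP r f 0 = emptyPart ↔ MultClosed r (Set.range (beta f (r * k))) := by
  have hN : plen f ≤ r * (plen f + 1) := by nlinarith
  rw [quotP, partOfBeta_eq_emptyPart_iff, eq_range_card_iff,
    multClosed_range_beta_congr hf hk hN, defaultN, ← coe_betaFinset]
  have hmem : ∀ B : Finset ℕ, ∀ j, j ∈ ((B.filter fun b => b % r = 0).image
      fun b => (b - 0) / r) ↔ r * j ∈ B := by
    intro B j
    simp only [Finset.mem_image, Finset.mem_filter, Nat.sub_zero]
    constructor
    · rintro ⟨b, ⟨hb, hbr⟩, rfl⟩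
      rwa [Nat.mul_div_cancel' (Nat.dvd_of_mod_eq_zero hbr)]
    · exact fun h => ⟨r * j, ⟨h, by simp⟩, Nat.mul_div_cancel_left j hr⟩
  simp only [hmem]
  constructor
  · rintro h x ⟨j, rfl⟩ hx
    exact h j hx
  · exact fun h j hj => h (r * j) (dvd_mul_right r j) hj

/-- Exponents whose multiples of `r` form an initial segment can be enumerated. -/
lemma exists_equiv_of_multClosed {ι : Type*} [Fintype ι] {r : ℕ} (hr : 0 < r) {β : ι → ℕ}
    (hβ : Function.Injective β) (h : MultClosed r (Set.range β)) :
    ∃ (c : ℕ) (e : Fin c ≃ {i // r ∣ β i}), ∀ j, β (e j) = r * beta emptyPart c j := by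
  obtain ⟨c, hc⟩ : ∃ c, ∀ k, r * k ∈ Set.range β ↔ k < c := by
    let s : Finset ℕ := Finset.univ.image fun i : {i // r ∣ β i} => β i / r
    have hs : ∀ k, k ∈ s ↔ r * k ∈ Set.range β := by
      intro k
      simp only [s, Finset.mem_image, Finset.mem_univ, true_and, Set.mem_range]
      constructor
      · rintro ⟨i, rfl⟩
        exact ⟨i, (Nat.mul_div_cancel' i.2).symm⟩
      · rintro ⟨i, hi⟩
        exact ⟨⟨i, hi ▸ dvd_mul_right r k⟩, by simp [hi, hr]⟩
    have hrange : s = Finset.range s.card := (eq_range_card_iff s).2 fun k hk => by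
      rw [hs] at hk ⊢
      exact h _ (dvd_mul_right r k) hk
    refine ⟨s.card, fun k => ?_⟩
    rw [← hs, ← Finset.mem_range, ← hrange]
  have hex : ∀ j : Fin c, ∃ i : {i // r ∣ β i}, β i = r * beta emptyPart c j := by
    intro j
    obtain ⟨i, hi⟩ := (hc (beta emptyPart c j)).2 (by simp only [beta, emptyPart]; omega)
    exact ⟨⟨i, hi ▸ dvd_mul_right r _⟩, hi⟩
  choose e he using hex
  refine ⟨c, Equiv.ofBijective e ⟨fun i j hij => ?_, fun i => ?_⟩, he⟩
  · refine beta_injective isPartition_emptyPart c (Nat.eq_of_mul_eq_mul_left hr ?_)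
    rw [← he, ← he, hij]
  · obtain ⟨k, hk⟩ := i.2
    have hkc : k < c := (hc k).1 ⟨i, hk⟩
    refine ⟨⟨c - 1 - k, by omega⟩, Subtype.ext (hβ ?_)⟩
    rw [he, hk]
    congr 1
    simp only [beta, emptyPart]
    omega

/-- An enumeration of the multiples of `r` makes them an initial segment. -/
lemma multClosed_of_equiv {ι : Type*} {r : ℕ} (hr : 0 < r) {β : ι → ℕ} {c : ℕ}
    (e : Fin c ≃ {i // r ∣ β i}) (he : ∀ j, β (e j) = r * beta emptyPart c j) :
    MultClosed r (Set.range β) := by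
  rintro x hx ⟨i, hi⟩
  have hd : r ∣ β i := hi ▸ Dvd.dvd.add hx dvd_rfl
  obtain ⟨x, rfl⟩ := hx
  have h1 := he (e.symm ⟨i, hd⟩)
  set j := e.symm ⟨i, hd⟩ with hj
  have hej : (e j : ι) = i := by simp [hj]
  rw [hej, hi, ← Nat.mul_succ] at h1
  have h2 := Nat.eq_of_mul_eq_mul_left hr h1
  simp only [beta, emptyPart, zero_add] at h2
  refine ⟨e ⟨j + 1, by omega⟩, ?_⟩
  rw [he]
  congr 1
  simp only [beta, emptyPart]
  omega

/-! ### The plethystic basis of `Λ` -/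

section Basis

open MvPolynomial

variable {ι : Type*}

/-- Replace the values of `b` divisible by `r` by prescribed multiples of `r`. -/
lemma exists_replace {r : ℕ} (hr : 0 < r) {b : ι → ℕ} (hb : Function.Injective b) {c : ℕ}
    (e : Fin c ≃ {i // r ∣ b i}) {g : Fin c → ℕ} (hg : Function.Injective g) :
    ∃ (β : ι → ℕ) (e' : Fin c ≃ {i // r ∣ β i}), Function.Injective β ∧
      (∀ j, (e' j : ι) = e j) ∧ (∀ j, β (e' j) = r * g j) ∧ (∀ i, ¬ r ∣ b i → β i = b i) ∧
      ∀ i, r ∣ β i ↔ r ∣ b i := by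
  let β : ι → ℕ := fun i => if h : r ∣ b i then r * g (e.symm ⟨i, h⟩) else b i
  have hon : ∀ i (h : r ∣ b i), β i = r * g (e.symm ⟨i, h⟩) := fun i h => dif_pos h
  have hoff : ∀ i, ¬ r ∣ b i → β i = b i := fun i h => dif_neg h
  have hdvd : ∀ i, r ∣ β i ↔ r ∣ b i := fun i => by
    by_cases h : r ∣ b i
    · simp [hon i h, h]
    · rw [hoff i h]
  refine ⟨β, e.trans (Equiv.subtypeEquivRight fun i => (hdvd i).symm), fun i j hij => ?_,
    fun j => rfl, fun j => ?_, hoff, hdvd⟩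
  · have hiff : r ∣ b i ↔ r ∣ b j := by rw [← hdvd, ← hdvd, hij]
    by_cases hi : r ∣ b i
    · have hj := hiff.1 hi
      rw [hon i hi, hon j hj] at hij
      have := e.symm.injective (hg (Nat.eq_of_mul_eq_mul_left hr hij))
      exact congrArg Subtype.val this
    · rw [hoff i hi, hoff j (mt hiff.2 hi)] at hij
      exact hb hij
  · have := hon (e j) (e j).2
    simpa using this

lemma exists_perm_of_range_eq {b d : ι → ℕ} (hb : Function.Injective b)
    (hd : Function.Injective d) (h : Set.range d = Set.range b) :
    ∃ τ : Equiv.Perm ι, d = b ∘ τ := by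
  refine ⟨(Equiv.ofInjective d hd).trans ((Equiv.setCongr h).trans (Equiv.ofInjective b hb).symm),
    funext fun i => ?_⟩
  have := Equiv.apply_ofInjective_symm hb (Equiv.setCongr h (Equiv.ofInjective d hd i))
  exact this.symm

lemma range_subset_of_ground {β β' : ι → ℕ} {r c : ℕ} (e : Fin c ≃ {i // r ∣ β i})
    (he : ∀ j, β (e j) = r * beta emptyPart c j) (e' : Fin c ≃ {i // r ∣ β' i})
    (he' : ∀ j, β' (e' j) = r * beta emptyPart c j)
    (h : ∀ x, ¬ r ∣ x → x ∈ Set.range β → x ∈ Set.range β') : Set.range β ⊆ Set.range β' := by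
  rintro _ ⟨i, rfl⟩
  by_cases hi : r ∣ β i
  · refine ⟨e' (e.symm ⟨i, hi⟩), ?_⟩
    have := he (e.symm ⟨i, hi⟩)
    rw [Equiv.apply_symm_apply] at this
    rw [he', ← this]
  · exact h _ hi ⟨i, rfl⟩

variable [Fintype ι]

lemma multSum_of_equiv {r : ℕ} {b : ι → ℕ} {c : ℕ} (e : Fin c ≃ {i // r ∣ b i}) {g : Fin c → ℕ}
    (h : ∀ j, b (e j) = r * g j) : multSum r b = r * ∑ j, g j := by
  rw [multSum_eq, ← Equiv.sum_comp e, Finset.mul_sum]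
  exact Finset.sum_congr rfl fun j _ => h j

lemma sum_add_multSum_of_replace {r : ℕ} {b β : ι → ℕ} (hoff : ∀ i, ¬ r ∣ b i → β i = b i)
    (hdvd : ∀ i, r ∣ β i ↔ r ∣ b i) :
    ∑ i, β i + multSum r b = ∑ i, b i + multSum r β := by
  rw [multSum, multSum, ← Finset.sum_add_distrib, ← Finset.sum_add_distrib]
  refine Finset.sum_congr rfl fun i _ => ?_
  by_cases h : r ∣ b i
  · rw [if_pos h, if_pos ((hdvd i).2 h), add_comm]
  · rw [if_neg h, if_neg (mt (hdvd i).1 h), hoff i h]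

variable {S : (ℕ → ℕ) → SymmAlg}

lemma coeff_expand_schur_eq_one [DecidableEq ι] (hS : IsSchurFamily S) {r : ℕ} (hr : 0 < r)
    {β : ι → ℕ} (hβ : Function.Injective β) {c : ℕ} (e : Fin c ≃ {i // r ∣ β i})
    (he : ∀ j, β (e j) = r * beta emptyPart c j) {f : ℕ → ℕ} (hf : IsPartition f)
    (hfc : plen f ≤ c) {b : ι →₀ ℕ} (hb : ∀ i, ¬ r ∣ β i → b i = β i)
    (hb' : ∀ j, b (e j) = r * beta f c j)
    (hsum : r * psize f + multSum r β ≤ multSum r b) :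
    coeff b (expand r (evOn ι (S f)) * alternant β) = 1 := by
  rw [coeff_expand_schur_mul hS hr hβ e he hf hfc hb (b' := beta f c ∘ e.symm)
    (fun i => by have := hb' (e.symm i); simpa using this) hsum]
  exact coeff_alternant_self ((beta_injective hf c).comp e.symm.injective) rfl

lemma multSum_of_ground {r : ℕ} {β β' : ι → ℕ} {c : ℕ} (e : Fin c ≃ {i // r ∣ β i})
    (he : ∀ j, β (e j) = r * beta emptyPart c j) (e' : Fin c ≃ {i // r ∣ β' i}) {f : ℕ → ℕ}
    (hf : IsPartition f) (hfc : plen f ≤ c) (he' : ∀ j, β' (e' j) = r * beta f c j) :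
    multSum r β' = r * psize f + multSum r β := by
  rw [multSum_of_equiv e he, multSum_of_equiv e' he', sum_beta hf hfc, Nat.mul_add]

/-- The products `S_ρ(x_1^r, x_2^r, …) S_μ`, for `ρ` a partition and `μ` a partition with
`μ[0] = ∅`. -/
noncomputable def plethProd (S : (ℕ → ℕ) → SymmAlg) (r : ℕ)
    (p : {f : ℕ → ℕ // IsPartition f} ×
      {f : ℕ → ℕ // IsPartition f ∧ quotP r f 0 = emptyPart}) : SymmAlg :=
  plethysm r (S p.1) * S p.2

lemma ev_plethProd_mul (hS : IsSchurFamily S) {r : ℕ} (hr : 0 < r)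
    (p : {f : ℕ → ℕ // IsPartition f} ×
      {f : ℕ → ℕ // IsPartition f ∧ quotP r f 0 = emptyPart}) {n : ℕ} (hn : plen p.2 ≤ n) :
    ev n (plethProd S r p) * alternant (beta emptyPart n) =
      expand r (evOn (Fin n) (S p.1)) * alternant (beta p.2 n) := by
  rw [plethProd, map_mul, mul_assoc, ev_schur_mul hS p.2.2.1 hn, ev_eq_evOn, evOn_plethysm hr]

lemma sum_le_totalDegree {A : MvPolynomial ι ℚ} {m : ι →₀ ℕ} (hm : m ∈ A.support) :
    ∑ i, m i ≤ A.totalDegree := by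
  have h := le_totalDegree hm
  rwa [Finsupp.sum_fintype _ _ fun _ => rfl] at h

/-- Straightening: subtracting the plethystic product with leading term `b` from the alternant
of `b` leaves alternants with smaller `multSum`. -/
lemma alternant_mem_span (hS : IsSchurFamily S) {r : ℕ} (hr : 0 < r) {k D : ℕ} {b : Fin (r * k) → ℕ}
    (hb : Function.Injective b) (hsum : ∑ i, b i ≤ D + ∑ i, beta emptyPart (r * k) i) :
    alternant b ∈ Submodule.span ℚ {P | ∃ ρ μ, IsPartition ρ ∧ psize ρ ≤ D ∧ IsPartition μ ∧
      psize μ ≤ D ∧ plen μ ≤ r * k ∧ quotP r μ 0 = emptyPart ∧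
      P = expand r (evOn (Fin (r * k)) (S ρ)) * alternant (beta μ (r * k))} := by
  induction hM : multSum r b using Nat.strong_induction_on generalizing b with
  | _ M ih =>
  obtain ⟨c, ⟨e₀⟩⟩ : ∃ c, Nonempty (Fin c ≃ {i // r ∣ b i}) :=
    ⟨_, ⟨(Fintype.equivFin {i // r ∣ b i}).symm⟩⟩
  obtain ⟨τ, ρ, hρ, hρc, hρb⟩ := exists_partition_of_injective (b := fun j => b (e₀ j) / r)
    fun i j hij => by
      have h1 := Nat.mul_div_cancel' (e₀ i).2
      have h2 := Nat.mul_div_cancel' (e₀ j).2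
      simp only at hij
      rw [hij, h2] at h1
      exact e₀.injective (Subtype.ext (hb h1.symm))
  let e := τ.trans e₀
  have hbe : ∀ j, b (e j) = r * beta ρ c j := fun j => by
    rw [hρb]; exact (Nat.mul_div_cancel' (e₀ (τ j)).2).symm
  obtain ⟨β, e', hβ, hee', he', hoff, hdvd⟩ :=
    exists_replace hr hb e (beta_injective isPartition_emptyPart c)
  have hoff' : ∀ i, ¬ r ∣ β i → b i = β i := fun i hi => (hoff i (mt (hdvd i).2 hi)).symm
  have hbe' : ∀ j, b (e' j) = r * beta ρ c j := fun j => by rw [hee', hbe]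
  have hmult : multSum r b = r * psize ρ + multSum r β := multSum_of_ground e' he' e hρ hρc hbe
  have hsumβ := sum_add_multSum_of_replace hoff hdvd
  obtain ⟨μ, hμ, hμn, hμβ, hmem⟩ := exists_partition_alternant_mem hβ
  have hsumμ := sum_beta hμ hμn
  have hsumμβ := sum_eq_of_range_eq (beta_injective hμ _) hβ hμβ id
  simp only [id] at hsumμβ
  have hρr : psize ρ ≤ r * psize ρ := Nat.le_mul_of_pos_left _ hr
  have hq : quotP r μ 0 = emptyPart := by
    rw [quotP_zero_eq_emptyPart_iff hμ hr hμn, hμβ]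
    exact multClosed_of_equiv hr e' he'
  set T := Submodule.span ℚ {P | ∃ ρ μ, IsPartition ρ ∧ psize ρ ≤ D ∧ IsPartition μ ∧
      psize μ ≤ D ∧ plen μ ≤ r * k ∧ quotP r μ 0 = emptyPart ∧
      P = expand r (evOn (Fin (r * k)) (S ρ)) * alternant (beta μ (r * k))} with hT
  set P := expand r (evOn (Fin (r * k)) (S ρ)) * alternant β with hP
  have hPT : P ∈ T := by
    obtain ⟨q, hq'⟩ := Submodule.mem_span_singleton.1 hmem
    rw [hP, ← hq', mul_smul_comm]
    exact Submodule.smul_mem _ _ (Submodule.subset_span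
      ⟨ρ, μ, hρ, by omega, hμ, by omega, hμn, hq, rfl⟩)
  have hA : IsAlternating (P - alternant b) := by
    refine IsAlternating.sub ?_ (isAlternating_alternant b)
    rw [hP, ← evOn_plethysm hr]
    exact (isAlternating_alternant β).evOn_mul _
  suffices h : P - alternant b ∈ T by
    have := Submodule.sub_mem _ hPT h
    rwa [sub_sub_cancel] at this
  refine Submodule.span_le.2 ?_ hA.mem_span
  rintro _ ⟨m, hm, hinj, rfl⟩
  have hcard : c ≤ Fintype.card (Fin (r * k)) := by
    rw [← Fintype.card_fin c, Fintype.card_congr e]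
    exact Fintype.card_subtype_le _
  have hPdeg : P.totalDegree ≤ ∑ i, b i := by
    refine (totalDegree_mul _ _).trans ?_
    rw [totalDegree_expand, totalDegree_alternant hβ]
    have h1 := Nat.mul_le_mul_left r
      (totalDegree_evOn_schur_le (ι := Fin (r * k)) hS hρ (hρc.trans hcard))
    rw [mul_comm]
    omega
  have hmsum : ∑ i, m i ≤ ∑ i, b i := (sum_le_totalDegree hm).trans
    ((totalDegree_sub _ _).trans (max_le hPdeg (totalDegree_alternant hb).le))
  have hnot : ¬ ∃ σ : Equiv.Perm (Fin (r * k)), (m : Fin (r * k) → ℕ) = b ∘ σ := by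
    rintro ⟨σ, hσ⟩
    refine mem_support_iff.1 hm ?_
    rw [hA.coeff_comp σ (m := Finsupp.equivFunOnFinite.symm b) hσ, coeff_sub,
      coeff_alternant_self hb rfl, hP,
      coeff_expand_schur_eq_one hS hr hβ e' he' hρ hρc hoff' hbe' hmult.ge, sub_self, mul_zero]
  have hmP : coeff m P ≠ 0 := by
    have h1 : coeff m (alternant b) = 0 := by
      by_contra h
      obtain ⟨σ, hσ⟩ := exists_perm_of_coeff_alternant_ne_zero h
      exact hnot ⟨σ, hσ.symm⟩
    have h2 := mem_support_iff.1 hm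
    rwa [coeff_sub, h1, sub_zero] at h2
  obtain ⟨-, hle, hrange⟩ := coeff_expand_schur_ne_zero hS hr hβ e' he' hρ hρc hmP
  obtain ⟨-, -, hrange'⟩ := coeff_expand_schur_ne_zero hS hr hβ e' he' hρ hρc
    (b := Finsupp.equivFunOnFinite.symm b) (by
      rw [coeff_expand_schur_eq_one hS hr hβ e' he' hρ hρc hoff' hbe' hmult.ge]
      exact one_ne_zero)
  refine ih (multSum r m) ?_ hinj (hmsum.trans hsum) rfl
  rw [← hM]
  by_contra hge
  refine hnot (exists_perm_of_range_eq hb hinj (Set.ext fun x => ?_))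
  rw [hrange (by omega) x]
  exact (hrange' hmult.ge x).symm

lemma span_plethProd (hS : IsSchurFamily S) {r : ℕ} (hr : 0 < r) :
    Submodule.span ℚ (Set.range (plethProd S r)) = ⊤ := by
  rw [eq_top_iff]
  rintro F -
  refine Submodule.span_le.2 ?_ (mem_span_schur hS F)
  rintro _ ⟨f, hf, rfl⟩
  set s := plethProd S r '' {p | psize p.1 ≤ psize f ∧ psize p.2 ≤ psize f} with hs
  have hfin : s.Finite := by
    refine Set.Finite.image _ ?_
    refine (Set.Finite.prod (s := {p : {f : ℕ → ℕ // IsPartition f} | psize p ≤ psize f})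
      (t := {p : {f : ℕ → ℕ // IsPartition f ∧ quotP r f 0 = emptyPart} | psize p ≤ psize f})
      ?_ ?_).subset fun p hp => hp
    · refine Set.Finite.of_finite_image (f := Subtype.val) ?_ Subtype.val_injective.injOn
      refine (finite_partitions (psize f)).subset ?_
      rintro _ ⟨p, hp, rfl⟩
      exact ⟨p.2, hp⟩
    · refine Set.Finite.of_finite_image (f := Subtype.val) ?_ Subtype.val_injective.injOn
      refine (finite_partitions (psize f)).subset ?_
      rintro _ ⟨p, hp, rfl⟩
      exact ⟨p.2.1, hp⟩
  refine Submodule.span_mono (Set.image_subset_range _ _)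
    (mem_span_of_frequently_ev_mul hfin fun n₀ => ⟨r * (n₀ + plen f), ?_, ?_⟩)
  · nlinarith
  · have hn : plen f ≤ r * (n₀ + plen f) := by nlinarith
    rw [ev_schur_mul hS hf hn]
    refine Submodule.span_mono ?_
      (alternant_mem_span hS hr (beta_injective hf _) (sum_beta hf hn).le)
    rintro _ ⟨ρ, μ, hρ, hρD, hμ, hμD, hμn, hq, rfl⟩
    refine ⟨_, ⟨(⟨ρ, hρ⟩, ⟨μ, hμ, hq⟩), ⟨hρD, hμD⟩, rfl⟩, ?_⟩
    exact ev_plethProd_mul hS hr (⟨ρ, hρ⟩, ⟨μ, hμ, hq⟩) hμn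

/-- In sufficiently many variables there are many beta numbers divisible by `r`. -/
lemma le_of_ground {f : ℕ → ℕ} (hf : IsPartition f) {r K : ℕ} (hr : 0 < r) (hK : plen f ≤ K)
    {c : ℕ} (e : Fin c ≃ {i // r ∣ beta f (r * (2 * K)) i})
    (he : ∀ j, beta f (r * (2 * K)) (e j) = r * beta emptyPart c j) : K ≤ c := by
  by_contra hc
  have h1 : r * c + r ≤ r * K := by
    rw [← Nat.mul_succ]; exact Nat.mul_le_mul_left r (by omega)
  have h2 : K ≤ r * K := Nat.le_mul_of_pos_left _ hr
  have h3 : r * (2 * K) = r * K + r * K := by ring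
  have hlt : r * (2 * K) - 1 - r * c < r * (2 * K) := by omega
  obtain ⟨i, hi⟩ : ∃ i, beta f (r * (2 * K)) i = r * c := by
    refine ⟨⟨r * (2 * K) - 1 - r * c, hlt⟩, ?_⟩
    simp only [beta, (plen_le_iff hf).1 hK (r * (2 * K) - 1 - r * c) (by omega)]
    omega
  obtain ⟨j, hj⟩ := e.surjective ⟨i, hi ▸ dvd_mul_right r c⟩
  have h5 := he j
  rw [hj, hi] at h5
  have h6 := Nat.eq_of_mul_eq_mul_left hr h5
  simp only [beta, emptyPart] at h6
  omega

lemma range_beta_subset {f g : ℕ → ℕ} {r c : ℕ} (hr : 0 < r) {B B' : Set ℕ}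
    (h : ∀ x, ((x ∈ B ∧ ¬ r ∣ x) ∨ ∃ j, x = r * beta f c j) →
      ((x ∈ B' ∧ ¬ r ∣ x) ∨ ∃ j, x = r * beta g c j)) :
    Set.range (beta f c) ⊆ Set.range (beta g c) := by
  rintro _ ⟨j, rfl⟩
  rcases h _ (Or.inr ⟨j, rfl⟩) with ⟨-, h⟩ | ⟨j', h⟩
  · exact absurd (dvd_mul_right r _) h
  · exact ⟨j', (Nat.eq_of_mul_eq_mul_left hr h).symm⟩

lemma linearIndependent_plethProd (hS : IsSchurFamily S) {r : ℕ} (hr : 0 < r) :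
    LinearIndependent ℚ (plethProd S r) := by
  rw [linearIndependent_iff]
  intro l hl
  by_contra hne
  obtain ⟨p₀, hp₀, hmax⟩ := l.support.exists_max_image (fun p => psize p.1)
    (Finsupp.support_nonempty_iff.2 hne)
  set K := l.support.sup fun p => max (plen p.1) (plen p.2) with hKdef
  have hK : ∀ p ∈ l.support, plen p.1 ≤ K ∧ plen p.2 ≤ K := fun p hp =>
    max_le_iff.1 (Finset.le_sup (f := fun p => max (plen p.1.1) (plen p.2.1)) hp)
  have hn : K ≤ r * (2 * K) := by nlinarith
  have hground : ∀ p ∈ l.support, ∃ (c : ℕ) (e : Fin c ≃ {i // r ∣ beta p.2 (r * (2 * K)) i}),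
      (∀ j, beta p.2 (r * (2 * K)) (e j) = r * beta emptyPart c j) ∧ K ≤ c := by
    intro p hp
    obtain ⟨c, e, he⟩ := exists_equiv_of_multClosed hr (beta_injective p.2.2.1 (r * (2 * K)))
      ((quotP_zero_eq_emptyPart_iff p.2.2.1 hr ((hK p hp).2.trans hn)).1 p.2.2.2)
    exact ⟨c, e, he, le_of_ground p.2.2.1 hr (hK p hp).2 e he⟩
  obtain ⟨c, e, he, hc⟩ := hground p₀ hp₀
  have hβ := beta_injective p₀.2.2.1 (r * (2 * K))
  obtain ⟨b, e', hb, hee', he', hoff, hdvd⟩ :=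
    exists_replace hr hβ e (beta_injective p₀.1.2 c)
  have hpc := (hK p₀ hp₀).1.trans hc
  have hmult := multSum_of_ground e he e' p₀.1.2 hpc he'
  have hone := coeff_expand_schur_eq_one hS hr hβ e he p₀.1.2 hpc
    (b := Finsupp.equivFunOnFinite.symm b) hoff (fun j => by rw [← hee']; exact he' j) hmult.ge
  obtain ⟨⟨e₁⟩, -, hrange⟩ := coeff_expand_schur_ne_zero hS hr hβ e he p₀.1.2 hpc
    (by rw [hone]; exact one_ne_zero)
  replace hrange := hrange hmult.ge
  have hzero := congrArg (fun F => coeff (Finsupp.equivFunOnFinite.symm b)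
    (ev (r * (2 * K)) F * alternant (beta emptyPart (r * (2 * K))))) hl
  simp only [map_zero, zero_mul, coeff_zero, Finsupp.linearCombination_apply, Finsupp.sum,
    map_sum, Finset.sum_mul, coeff_sum, map_smul, smul_mul_assoc, coeff_smul] at hzero
  rw [Finset.sum_eq_single_of_mem p₀ hp₀, ev_plethProd_mul hS hr p₀ ((hK p₀ hp₀).2.trans hn),
    hone, smul_eq_mul, mul_one] at hzero
  · exact Finsupp.mem_support_iff.1 hp₀ hzero
  intro p hp hpne
  rw [ev_plethProd_mul hS hr p ((hK p hp).2.trans hn)]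
  by_contra hcoeff
  obtain ⟨c', f, hf, hc'⟩ := hground p hp
  have hpc' := (hK p hp).1.trans hc'
  obtain ⟨⟨e₂⟩, -, hrange'⟩ := coeff_expand_schur_ne_zero hS hr
    (beta_injective p.2.2.1 (r * (2 * K))) f hf p.1.2 hpc' (right_ne_zero_of_mul hcoeff)
  obtain rfl : c' = c := Fin.equiv_iff_eq.1 ⟨e₂.trans e₁.symm⟩
  replace hrange' := hrange' (by
    have h1 : multSum r (beta p.2 (r * (2 * K))) = multSum r (beta p₀.2 (r * (2 * K))) := by
      rw [multSum_of_equiv f hf, multSum_of_equiv e he]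
    have h2 := Nat.mul_le_mul_left r (hmax p hp)
    simp only [Finsupp.coe_equivFunOnFinite_symm]
    omega)
  have hiff := fun x => (hrange x).symm.trans (hrange' x)
  refine hpne (Prod.ext (Subtype.ext ?_) (Subtype.ext ?_))
  · exact eq_of_range_beta_eq p.1.2 p₀.1.2 hpc' hpc ((range_beta_subset hr fun x =>
      (hiff x).2).antisymm (range_beta_subset hr fun x => (hiff x).1))
  · refine eq_of_range_beta_eq p.2.2.1 p₀.2.2.1 ((hK p hp).2.trans hn) ((hK p₀ hp₀).2.trans hn)
      ((range_subset_of_ground f hf e he fun x hx hxB => ?_).antisymm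
        (range_subset_of_ground e he f hf fun x hx hxB => ?_))
    · rcases (hiff x).2 (Or.inl ⟨hxB, hx⟩) with h | ⟨j, rfl⟩
      · exact h.1
      · exact absurd (dvd_mul_right r _) hx
    · rcases (hiff x).1 (Or.inl ⟨hxB, hx⟩) with h | ⟨j, rfl⟩
      · exact h.1
      · exact absurd (dvd_mul_right r _) hx

end Basis

/-! ### Reduction -/

section Reduction

open MvPolynomial

lemma rho_X_of_dvd {r m : ℕ} (h : r ∣ m + 1) : rho r (X m) = 0 := by
  simp [rho, h]

lemma rho_X_of_not_dvd {r m : ℕ} (h : ¬ r ∣ m + 1) :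
    rho r (X m) = ((m + 1 : ℕ) : ℚ) • X ⟨m + 1, Nat.succ_pos m, h⟩ := by
  simp only [rho, aeval_X, dif_neg h]

lemma rho_plethysm {r : ℕ} (hr : 0 < r) (F : SymmAlg) :
    rho r (plethysm r F) = C (constantCoeff F) := by
  induction F using MvPolynomial.induction_on with
  | C a => simp [plethysm, rho]
  | add p q hp hq => simp [hp, hq]
  | mul_X p j _ =>
    have h : r ∣ r * (j + 1) - 1 + 1 := by
      rw [Nat.sub_add_cancel (Nat.mul_pos hr j.succ_pos)]; exact dvd_mul_right _ _
    have h1 : plethysm r (X j) = X (r * (j + 1) - 1) := by simp [plethysm]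
    rw [map_mul, map_mul, h1, rho_X_of_dvd h]
    simp

/-- The section `t_j ↦ p_j / j` of `ρ^(r)`. -/
noncomputable def rhoSection (r : ℕ) : PR r →ₐ[ℚ] SymmAlg :=
  aeval fun j => ((j : ℕ) : ℚ)⁻¹ • X ((j : ℕ) - 1)

lemma rho_rhoSection (r : ℕ) (P : PR r) : rho r (rhoSection r P) = P := by
  have : (rho r).comp (rhoSection r) = AlgHom.id ℚ (PR r) := by
    ext1 ⟨j, hpos, hj⟩
    obtain ⟨j, rfl⟩ := Nat.exists_eq_add_of_le' hpos
    have h0 : ((j + 1 : ℕ) : ℚ) ≠ 0 := Nat.cast_ne_zero.2 j.succ_ne_zero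
    simp only [AlgHom.comp_apply, rhoSection, aeval_X, map_smul, Nat.add_sub_cancel,
      rho_X_of_not_dvd hj, smul_smul, inv_mul_cancel₀ h0, one_smul, AlgHom.id_apply]
  exact DFunLike.congr_fun this P

lemma rho_surjective (r : ℕ) : Function.Surjective (rho r) :=
  fun P => ⟨_, rho_rhoSection r P⟩

lemma sub_rhoSection_mem (r : ℕ) (F : SymmAlg) :
    F - rhoSection r (rho r F) ∈ Ideal.span {G : SymmAlg | ∃ m, r ∣ m + 1 ∧ G = X m} := by
  induction F using MvPolynomial.induction_on with
  | C a => simp [rhoSection, rho]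
  | add p q hp hq =>
    rw [map_add, map_add, add_sub_add_comm]
    exact Ideal.add_mem _ hp hq
  | mul_X p j hp =>
    have hX : X j - rhoSection r (rho r (X j)) ∈
        Ideal.span {G : SymmAlg | ∃ m, r ∣ m + 1 ∧ G = X m} := by
      by_cases h : r ∣ j + 1
      · rw [rho_X_of_dvd h, map_zero, sub_zero]
        exact Ideal.subset_span ⟨j, h, rfl⟩
      · have h0 : ((j + 1 : ℕ) : ℚ) ≠ 0 := Nat.cast_ne_zero.2 j.succ_ne_zero
        rw [rho_X_of_not_dvd h, map_smul, rhoSection, aeval_X, smul_smul, mul_inv_cancel₀ h0,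
          one_smul, Nat.add_sub_cancel, sub_self]
        exact Ideal.zero_mem _
    have h1 : p * X j - rhoSection r (rho r (p * X j)) =
        p * (X j - rhoSection r (rho r (X j))) +
          rhoSection r (rho r (X j)) * (p - rhoSection r (rho r p)) := by
      rw [map_mul, map_mul]; ring
    rw [h1]
    exact Ideal.add_mem _ (Ideal.mul_mem_left _ _ hX) (Ideal.mul_mem_left _ _ hp)

variable {S : (ℕ → ℕ) → SymmAlg}

lemma mem_span_schur_of_constantCoeff (hS : IsSchurFamily S) {F : SymmAlg}
    (hF : constantCoeff F = 0) :
    F ∈ Submodule.span ℚ (S '' {f | IsPartition f ∧ f ≠ emptyPart}) := by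
  have h : F ∈ Submodule.span ℚ
      (insert (S emptyPart) (S '' {f | IsPartition f ∧ f ≠ emptyPart})) := by
    refine Submodule.span_mono ?_ (mem_span_schur hS F)
    rintro _ ⟨f, hf, rfl⟩
    by_cases h : f = emptyPart
    · exact Or.inl (by rw [h])
    · exact Or.inr ⟨f, ⟨hf, h⟩, rfl⟩
  have hspan : ∀ z ∈ Submodule.span ℚ (S '' {f | IsPartition f ∧ f ≠ emptyPart}),
      constantCoeff z = 0 := by
    intro z hz
    induction hz using Submodule.span_induction with
    | mem x hx =>
      obtain ⟨f, ⟨hf, hne⟩, rfl⟩ := hx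
      exact constantCoeff_schur hS hf hne
    | zero => simp
    | add x y _ _ hx hy => rw [map_add, hx, hy, add_zero]
    | smul c x _ hx => rw [smul_eq_C_mul, map_mul, hx, mul_zero]
  obtain ⟨a, z, hz, rfl⟩ := Submodule.mem_span_insert.1 h
  have ha : a = 0 := by
    simpa [schur_emptyPart hS, hspan z hz, smul_eq_C_mul] using hF
  rwa [ha, zero_smul, zero_add]

lemma mul_X_mem_span (hS : IsSchurFamily S) {r m : ℕ} (hr : 0 < r) (hm : r ∣ m + 1)
    (G : SymmAlg) :
    G * X m ∈ Submodule.span ℚ (plethProd S r '' {p | p.1.1 ≠ emptyPart}) := by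
  have hG : G ∈ Submodule.span ℚ (Set.range (plethProd S r)) := by
    rw [span_plethProd hS hr]; trivial
  induction hG using Submodule.span_induction with
  | zero => simp
  | add x y _ _ hx hy => rw [add_mul]; exact Submodule.add_mem _ hx hy
  | smul c x _ hx => rw [smul_mul_assoc]; exact Submodule.smul_mem _ c hx
  | mem x hx =>
    obtain ⟨⟨ρ, μ⟩, rfl⟩ := hx
    obtain ⟨l, hl⟩ := hm
    obtain ⟨l, rfl⟩ : ∃ k, l = k + 1 := Nat.exists_eq_succ_of_ne_zero fun h => by
      rw [h] at hl; simp at hl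
    have hX : plethysm r (X l) = X m := by
      simp [plethysm, ← hl]
    have h1 : plethProd S r (ρ, μ) * X m = plethysm r (S ρ * X l) * S μ := by
      rw [plethProd, map_mul, hX]; ring
    have h2 := mem_span_schur_of_constantCoeff hS (F := S ρ * X l) (by simp)
    rw [h1]
    have h3 := Submodule.mem_map_of_mem
      (f := (LinearMap.mulRight ℚ (S μ)).comp (plethysm r).toLinearMap) h2
    rw [Submodule.map_span] at h3
    refine Submodule.span_mono ?_ h3
    rintro _ ⟨_, ⟨κ, ⟨hκ, hne⟩, rfl⟩, rfl⟩
    exact ⟨(⟨κ, hκ⟩, μ), hne, rfl⟩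

lemma mem_span_of_rho_eq_zero (hS : IsSchurFamily S) {r : ℕ} (hr : 0 < r) {F : SymmAlg}
    (hF : rho r F = 0) :
    F ∈ Submodule.span ℚ (plethProd S r '' {p | p.1.1 ≠ emptyPart}) := by
  have h := sub_rhoSection_mem r F
  rw [hF, map_zero, sub_zero] at h
  suffices h1 : ∀ G, G * F ∈ Submodule.span ℚ (plethProd S r '' {p | p.1.1 ≠ emptyPart}) by
    simpa using h1 1
  clear hF
  induction h using Submodule.span_induction with
  | mem x hx =>
    obtain ⟨m, hm, rfl⟩ := hx
    exact mul_X_mem_span hS hr hm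
  | zero => simp
  | add x y _ _ hx hy => intro G; rw [mul_add]; exact Submodule.add_mem _ (hx G) (hy G)
  | smul a x _ hx => intro G; rw [smul_eq_mul, ← mul_assoc]; exact hx _

lemma plethProd_emptyPart (hS : IsSchurFamily S) (r : ℕ)
    (μ : {f : ℕ → ℕ // IsPartition f ∧ quotP r f 0 = emptyPart}) :
    plethProd S r (⟨emptyPart, isPartition_emptyPart⟩, μ) = S μ := by
  rw [plethProd, schur_emptyPart hS, map_one, one_mul]

end Reduction

/-- **Proposition 3.3.** The set `{S^(r)_λ : λ a partition with λ[0] = ∅}` is a basis of the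
ℚ-vector space `P^(r)`. -/
theorem reduced_schur_basis
    (r : ℕ) (hr : 2 ≤ r)
    (S : (ℕ → ℕ) → SymmAlg) (hS : IsSchurFamily S) :
    LinearIndependent ℚ
      (fun p : {f : ℕ → ℕ // IsPartition f ∧ quotP r f 0 = emptyPart} => rho r (S p.1)) ∧
    Submodule.span ℚ
      (Set.range fun p : {f : ℕ → ℕ // IsPartition f ∧ quotP r f 0 = emptyPart} =>
        rho r (S p.1)) = ⊤ := by
  have hr0 : 0 < r := by omega
  have hli := linearIndependent_plethProd hS hr0
  let i : {f : ℕ → ℕ // IsPartition f ∧ quotP r f 0 = emptyPart} →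
      {f : ℕ → ℕ // IsPartition f} × {f : ℕ → ℕ // IsPartition f ∧ quotP r f 0 = emptyPart} :=
    fun μ => (⟨emptyPart, isPartition_emptyPart⟩, μ)
  have hi : plethProd S r ∘ i = fun μ => S μ.1 := funext fun μ => plethProd_emptyPart hS r μ
  constructor
  · have hS' : LinearIndependent ℚ
        (fun μ : {f : ℕ → ℕ // IsPartition f ∧ quotP r f 0 = emptyPart} => S μ.1) :=
      hi ▸ hli.comp i fun x y h => congrArg Prod.snd h
    refine hS'.map (f := (rho r).toLinearMap) (Submodule.disjoint_def.2 fun F hF hker => ?_)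
    have hdisj := hli.disjoint_span_image (s := {p | p.1.1 = emptyPart})
      (t := {p | p.1.1 ≠ emptyPart}) (Set.disjoint_left.2 fun p h h' => h' h)
    refine Submodule.disjoint_def.1 hdisj F (Submodule.span_mono ?_ hF)
      (mem_span_of_rho_eq_zero hS hr0 hker)
    rintro _ ⟨μ, rfl⟩
    exact ⟨i μ, rfl, plethProd_emptyPart hS r μ⟩
  · rw [eq_top_iff]
    rintro P -
    obtain ⟨F, rfl⟩ := rho_surjective r P
    have hF : F ∈ Submodule.span ℚ (Set.range (plethProd S r)) := by
      rw [span_plethProd hS hr0]; trivial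
    have h := Submodule.mem_map_of_mem (f := (rho r).toLinearMap) hF
    rw [Submodule.map_span] at h
    refine Submodule.span_le.2 ?_ h
    rintro _ ⟨_, ⟨p, rfl⟩, rfl⟩
    have h1 : (rho r).toLinearMap (plethProd S r p) =
        MvPolynomial.constantCoeff (S p.1) • rho r (S p.2) := by
      rw [AlgHom.toLinearMap_apply, plethProd, map_mul, rho_plethysm hr0,
        MvPolynomial.smul_eq_C_mul]
    rw [h1]
    exact Submodule.smul_mem _ _ (Submodule.subset_span ⟨p.2, rfl⟩)

end RSF
end

section
/- For every α ∈ M and every j ≥ 1, all but finitely many of the images of u_{α+jε_i} (i ≥ 1) vanish in U, so Σ_{i≥1} u_{α+jε_i} is a well-defined element of U. Let U_1 be the quotient of U by the subspace spanned by all the elements Σ_{i≥1} u_{α+jε_i}, for α ∈ M and j ≥ 1. Then U_1 is a one-dimensional ℚ-vector space, i.e. U_1 ≅ ℚ. -/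
open scoped BigOperators Classical

namespace RSF

/-- The generalized Maya diagram represented by a Maya sequence. -/
def MSeq.toCl (a : MSeq) : MayaCl := Quotient.mk mayaSetoid a

/-- The image of `u_a` in `U`, for a Maya sequence `a`. -/
noncomputable def uSeq (a : MSeq) : Usp := Submodule.Quotient.mk (Finsupp.single a.toCl 1)

lemma MSeq.exists_tail (a : MSeq) : ∃ (N : ℕ) (C : ℤ), ∀ i, N ≤ i → a.1 i = C - i := by
  obtain ⟨N, hN⟩ := a.2
  refine ⟨N, a.1 N + N, fun i hi => ?_⟩
  induction i, hi using Nat.le_induction with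
  | base => ring
  | succ n hn ih => rw [hN n hn, ih]; push_cast; ring

lemma addAtM_same (a : MSeq) (i : ℕ) (c : ℤ) : (addAtM a i c).1 i = a.1 i + c := by
  simp [addAtM, addAt]

lemma addAtM_of_ne (a : MSeq) {i m : ℕ} (c : ℤ) (h : m ≠ i) : (addAtM a i c).1 m = a.1 m := by
  simp [addAtM, addAt, h]

lemma uSeq_congr {a b : MSeq} (c : ℤ) (h : ∀ i, a.1 i = b.1 i + c) : uSeq a = uSeq b :=
  congrArg uCl (Quotient.sound (s := mayaSetoid) ⟨c, h⟩)

lemma uSeq_perm {n : ℕ} (σ : Equiv.Perm (Fin n)) (a : MSeq) :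
    uSeq (permActM σ a) = ((Equiv.Perm.sign σ : ℤ) : ℚ) • uSeq a := by
  unfold uSeq
  rw [← Submodule.Quotient.mk_smul, Submodule.Quotient.eq]
  exact Submodule.subset_span ⟨a, n, σ, rfl⟩

lemma uSeq_swap {a b : MSeq} {i l : ℕ} (hil : i ≠ l) (hi : b.1 i = a.1 l) (hl : b.1 l = a.1 i)
    (h : ∀ m, m ≠ i → m ≠ l → b.1 m = a.1 m) : uSeq b = -uSeq a := by
  have hin : i < i + l + 1 := by omega
  have hln : l < i + l + 1 := by omega
  set σ : Equiv.Perm (Fin (i + l + 1)) := Equiv.swap ⟨i, hin⟩ ⟨l, hln⟩ with hσ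
  have hb : uSeq b = uSeq (permActM σ a) := by
    refine uSeq_congr 0 fun m => ?_
    simp only [permActM, permAct, hσ, Equiv.swap_inv, add_zero]
    split_ifs with hm
    · rw [Equiv.swap_apply_def]
      simp only [Fin.ext_iff]
      split_ifs with h1 h2
      · simpa [h1] using hi
      · simpa [h2] using hl
      · exact h m h1 h2
    · exact h m (by omega) (by omega)
  have hs : Equiv.Perm.sign σ = -1 := Equiv.Perm.sign_swap (by simpa [Fin.ext_iff] using hil)
  rw [hb, uSeq_perm, hs]
  simp

lemma eq_zero_of_eq_neg_self {x : Usp} (h : x = -x) : x = 0 := by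
  have h2 : (2 : ℚ) • x = 0 := by rw [two_smul]; nth_rewrite 2 [h]; simp
  exact (smul_eq_zero.mp h2).resolve_left two_ne_zero

lemma uSeq_eq_zero {a : MSeq} {i l : ℕ} (hil : i ≠ l) (h : a.1 i = a.1 l) : uSeq a = 0 :=
  eq_zero_of_eq_neg_self (uSeq_swap hil h h.symm fun _ _ _ => rfl)

lemma uSeq_addAtM_support_finite (a : MSeq) {j : ℕ} (hj : 1 ≤ j) :
    {i : ℕ | uSeq (addAtM a i (j : ℤ)) ≠ 0}.Finite := by
  obtain ⟨N, C, h⟩ := a.exists_tail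
  refine (Set.finite_lt_nat (N + j)).subset fun i hi => ?_
  by_contra hlt
  simp only [Set.mem_ofPred_eq, not_lt] at hlt
  refine hi (uSeq_eq_zero (i := i) (l := i - j) (by omega) ?_)
  rw [addAtM_same, addAtM_of_ne _ _ (by omega), h i (by omega), h (i - j) (by omega)]
  push_cast [show j ≤ i by omega]
  ring

/-- The subspace of `U` spanned by the sums `Σ_i u_{a+jε_i}`. -/
noncomputable def sumSpan : Submodule ℚ Usp :=
  Submodule.span ℚ {v : Usp | ∃ (a : MSeq) (j : ℕ), 1 ≤ j ∧
    v = ∑ᶠ i : ℕ, uCl (Quotient.mk mayaSetoid (addAtM a i (j : ℤ)))}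

/-- The vacuum Maya sequence `(0, -1, -2, …)`. -/
def vac : MSeq := ⟨fun i => -(i : ℤ), 0, fun i _ => by push_cast; ring⟩

/-! ### The vacuum coefficient -/

/-- For `n` large, the signed indicator of `a` being a permutation of a shifted vacuum. -/
noncomputable def vacDet (n : ℕ) (a : ℕ → ℤ) : ℚ :=
  (Matrix.of fun i k : Fin n => if a i + k = a n + n then (1 : ℚ) else 0).det

lemma vacDet_succ {n : ℕ} {a : ℕ → ℤ} (h : a (n + 1) = a n - 1) :
    vacDet (n + 1) a = vacDet n a := by
  unfold vacDet
  rw [Matrix.det_succ_row _ (Fin.last n), Finset.sum_eq_single (Fin.last n)]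
  · have e : a (n + 1) + (n + 1 : ℤ) = a n + n := by rw [h]; ring
    simp only [Fin.val_last, Matrix.of_apply, Nat.cast_add, Nat.cast_one, e, if_true,
      ← two_mul, pow_mul, neg_one_sq, one_pow, one_mul]
    congr 1
    ext i k
    simp [Fin.succAbove_last]
  · intro k _ hk
    have : (k : ℕ) ≠ n := fun h => hk (Fin.ext h)
    have hne : ¬ (a n + (k : ℤ) = a (n + 1) + ((n + 1 : ℕ) : ℤ)) := by rw [h]; push_cast; omega
    simp only [Matrix.of_apply, Fin.val_last, if_neg hne, mul_zero, zero_mul]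
  · simp

/-- The coefficient of the vacuum in `u_a`. -/
noncomputable def vacCoeffSeq (a : MSeq) : ℚ := vacDet a.2.choose a.1

lemma vacCoeffSeq_eq_vacDet (a : MSeq) {n : ℕ} (hn : a.2.choose ≤ n) :
    vacCoeffSeq a = vacDet n a.1 := by
  induction n, hn using Nat.le_induction with
  | base => rfl
  | succ n hn ih => rw [ih, vacDet_succ (a.2.choose_spec n hn)]

lemma vacCoeffSeq_congr {a b : MSeq} (h : mayaSetoid.r a b) : vacCoeffSeq a = vacCoeffSeq b := by
  obtain ⟨c, h⟩ := h
  rw [vacCoeffSeq_eq_vacDet a (le_max_left _ b.2.choose),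
    vacCoeffSeq_eq_vacDet b (le_max_right a.2.choose _)]
  unfold vacDet
  congr 1
  ext i k
  simp only [Matrix.of_apply, h]
  congr 1
  exact propext ⟨fun _ => by omega, fun _ => by omega⟩

lemma permAct_castLEEmb {m n : ℕ} (h : m ≤ n) (σ : Equiv.Perm (Fin m)) (a : ℕ → ℤ) (i : Fin n) :
    permAct σ a i = a ((σ⁻¹).viaFintypeEmbedding (Fin.castLEEmb h) i : Fin n) := by
  unfold permAct
  split_ifs with hi
  · have : i = Fin.castLEEmb h ⟨i, hi⟩ := rfl
    conv_rhs => rw [this, Equiv.Perm.viaFintypeEmbedding_apply_image]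
    rfl
  · rw [Equiv.Perm.viaFintypeEmbedding_apply_notMem_range]
    rintro ⟨x, rfl⟩
    exact hi x.2

lemma vacCoeffSeq_perm {m : ℕ} (σ : Equiv.Perm (Fin m)) (a : MSeq) :
    vacCoeffSeq (permActM σ a) = ((Equiv.Perm.sign σ : ℤ) : ℚ) * vacCoeffSeq a := by
  obtain ⟨n, h1, h2, h3⟩ : ∃ n, a.2.choose ≤ n ∧ (permActM σ a).2.choose ≤ n ∧ m ≤ n :=
    ⟨_ + _ + _, by omega, Nat.le_add_left _ _ |>.trans (Nat.le_add_right _ _),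
      Nat.le_add_left m (a.2.choose + (permActM σ a).2.choose)⟩
  rw [vacCoeffSeq_eq_vacDet _ h1, vacCoeffSeq_eq_vacDet _ h2]
  have hs : Equiv.Perm.sign ((σ⁻¹).viaFintypeEmbedding (Fin.castLEEmb h3)) =
      Equiv.Perm.sign σ := by
    rw [Equiv.Perm.viaFintypeEmbedding_sign, Equiv.Perm.sign_inv]
  unfold vacDet
  rw [← hs, ← Matrix.det_permute]
  congr 1
  ext i k
  have hn : (permActM σ a).1 n = a.1 n := by simp [permActM, permAct, h3.not_gt]
  simp only [Matrix.of_apply, Matrix.submatrix_apply, id, hn]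
  rw [show (permActM σ a).1 i = _ from permAct_castLEEmb h3 σ a.1 i]

/-- The vacuum coefficient of a generalized Maya diagram. -/
noncomputable def vacCoeffCl (α : MayaCl) : ℚ :=
  Quotient.lift vacCoeffSeq (fun _ _ h => vacCoeffSeq_congr h) α

/-- The vacuum coefficient as a linear functional on `U`. -/
noncomputable def vacCoeff : Usp →ₗ[ℚ] ℚ :=
  (Submodule.span ℚ relSet).liftQ
    (Finsupp.linearCombination ℚ vacCoeffCl) <| by
    rw [Submodule.span_le]
    rintro _ ⟨a, n, σ, rfl⟩
    change Finsupp.linearCombination ℚ vacCoeffCl ((Finsupp.single (permActM σ a).toCl 1 : FreeM)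
      - ((Equiv.Perm.sign σ : ℤ) : ℚ) • (Finsupp.single a.toCl 1 : FreeM)) = 0
    rw [map_sub, map_smul, Finsupp.linearCombination_single, Finsupp.linearCombination_single,
      one_smul, one_smul, sub_eq_zero]
    exact vacCoeffSeq_perm σ a

lemma vacCoeff_uSeq (a : MSeq) : vacCoeff (uSeq a) = vacCoeffSeq a := by
  unfold uSeq vacCoeff
  rw [Submodule.liftQ_apply, Finsupp.linearCombination_single, one_smul]
  rfl

lemma vacCoeff_vac : vacCoeff (uSeq vac) = 1 := by
  rw [vacCoeff_uSeq, vacCoeffSeq, vacDet]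
  refine Eq.trans (congrArg Matrix.det ?_) Matrix.det_one
  ext i k
  rw [Matrix.of_apply, Matrix.one_apply]
  refine if_congr ?_ rfl rfl
  rw [Fin.ext_iff]
  simp only [vac]
  omega

lemma exists_eq_sub_of_vacCoeffSeq_ne_zero {b : MSeq} (h : vacCoeffSeq b ≠ 0) :
    ∀ i, ∀ j : ℕ, ∃ l, b.1 l = b.1 i - j := by
  obtain ⟨N, C, hC⟩ := b.exists_tail
  set n := b.2.choose + N with hn
  rw [vacCoeffSeq_eq_vacDet b (n := n) (by omega)] at h
  have hbn := hC n (by omega)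
  have row : ∀ i, ∃ k : ℕ, b.1 i = C - k := by
    intro i
    by_cases hi : n ≤ i
    · exact ⟨i, hC i (by omega)⟩
    by_contra! hne
    refine h (Matrix.det_eq_zero_of_row_eq_zero ⟨i, by omega⟩ fun k => ?_)
    have := hne k
    simp only [Matrix.of_apply]
    exact if_neg (by omega)
  have col : ∀ k : ℕ, ∃ l, b.1 l = C - k := by
    intro k
    by_cases hk : n ≤ k
    · exact ⟨k, hC k (by omega)⟩
    by_contra! hne
    refine h (Matrix.det_eq_zero_of_column_eq_zero ⟨k, by omega⟩ fun l => ?_)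
    have := hne l
    simp only [Matrix.of_apply]
    exact if_neg (by omega)
  intro i j
  obtain ⟨k, hk⟩ := row i
  obtain ⟨l, hl⟩ := col (k + j)
  exact ⟨l, by rw [hl, hk]; push_cast; ring⟩

lemma sumSpan_le_ker_vacCoeff : sumSpan ≤ LinearMap.ker vacCoeff := by
  unfold sumSpan
  rw [Submodule.span_le]
  rintro _ ⟨a, j, hj, rfl⟩
  simp only [SetLike.mem_coe, LinearMap.mem_ker]
  change vacCoeff (∑ᶠ i, uSeq (addAtM a i j)) = 0
  by_cases hz : ∀ i, vacCoeff (uSeq (addAtM a i j)) = 0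
  · have := vacCoeff.toAddMonoidHom.map_finsum (uSeq_addAtM_support_finite a hj)
    simpa [hz] using this
  push Not at hz
  obtain ⟨i, hi⟩ := hz
  rw [vacCoeff_uSeq] at hi
  obtain ⟨l, hl⟩ := exists_eq_sub_of_vacCoeffSeq_ne_zero hi i j
  have hli : l ≠ i := by
    rintro rfl
    omega
  rw [addAtM_same, addAtM_of_ne _ _ hli, add_sub_cancel_right] at hl
  have hsum : ∑ᶠ m, uSeq (addAtM a m j) = ∑ m ∈ ({l, i} : Finset ℕ), uSeq (addAtM a m j) := by
    refine finsum_eq_sum_of_support_subset _ fun m hm => ?_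
    by_contra hmem
    simp only [Finset.coe_insert, Finset.coe_singleton, Set.mem_insert_iff,
      Set.mem_singleton_iff, not_or] at hmem
    refine hm (uSeq_eq_zero hli ?_)
    rw [addAtM_of_ne _ _ (Ne.symm hmem.1), addAtM_of_ne _ _ (Ne.symm hmem.2), hl]
  have hneg : uSeq (addAtM a l j) = -uSeq (addAtM a i j) := by
    refine uSeq_swap hli ?_ ?_ fun m h1 h2 => ?_
    · rw [addAtM_same, addAtM_same, hl]
    · rw [addAtM_of_ne _ _ hli, addAtM_of_ne _ _ hli.symm, hl]
    · rw [addAtM_of_ne _ _ h1, addAtM_of_ne _ _ h2]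
  rw [hsum, Finset.sum_pair hli, hneg, neg_add_cancel, map_zero]

/-! ### The vacuum spans the quotient -/

/-- The sequence `a - jε_i + jε_k`. -/
def moveM (a : MSeq) (i j k : ℕ) : MSeq := addAtM (addAtM a i (-(j : ℤ))) k j

lemma moveM_left (a : MSeq) {i k : ℕ} (j : ℕ) (h : i ≠ k) :
    (moveM a i j k).1 i = a.1 i - j := by
  rw [moveM, addAtM_of_ne _ _ h, addAtM_same, sub_eq_add_neg]

lemma moveM_right (a : MSeq) {i k : ℕ} (j : ℕ) (h : i ≠ k) :
    (moveM a i j k).1 k = a.1 k + j := by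
  rw [moveM, addAtM_same, addAtM_of_ne _ _ h.symm]

lemma moveM_of_ne (a : MSeq) {i k m : ℕ} (j : ℕ) (h : m ≠ i) (h' : m ≠ k) :
    (moveM a i j k).1 m = a.1 m := by
  rw [moveM, addAtM_of_ne _ _ h', addAtM_of_ne _ _ h]

lemma uSeq_moveM_self (a : MSeq) (i j : ℕ) : uSeq (moveM a i j i) = uSeq a := by
  refine uSeq_congr 0 fun m => ?_
  by_cases h : m = i
  · subst h
    rw [moveM, addAtM_same, addAtM_same]
    ring
  · rw [moveM_of_ne _ _ h h, add_zero]

/-- The condition that `a - jε_i` is a nontrivial lowering of `a`. -/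
def Lowers (a : MSeq) (i j : ℕ) : Prop := 1 ≤ j ∧ ∀ l, a.1 l ≠ a.1 i - j

lemma uSeq_moveM_eq_zero {a : MSeq} {i j k l : ℕ} (h : Lowers a i j) (hik : i ≠ k)
    (hl : a.1 l = a.1 k + j) : uSeq (moveM a i j k) = 0 := by
  have hli : l ≠ i := by
    rintro rfl
    exact h.2 k (by omega)
  have hlk : l ≠ k := by
    rintro rfl
    have := h.1
    omega
  refine uSeq_eq_zero hlk ?_
  rw [moveM_of_ne _ _ hli hlk, moveM_right _ _ hik, hl]

/-- The triples `(i, j, k)` contributing off-diagonal terms to `Σ_j p_j p_j^⊥ u_a`. -/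
def OffDiag (a : MSeq) (p : ℕ × ℕ × ℕ) : Prop :=
  p.1 ≠ p.2.2 ∧ Lowers a p.1 p.2.1 ∧ ∀ l, a.1 l ≠ a.1 p.2.2 + p.2.1

/-- The sign-reversing involution on off-diagonal triples: it exchanges the two values
`a_i - j` and `a_k + j`. -/
noncomputable def exchange (a : MSeq) (p : ℕ × ℕ × ℕ) : ℕ × ℕ × ℕ :=
  if (p.2.1 : ℤ) < a.1 p.1 - a.1 p.2.2 then
    (p.1, (a.1 p.1 - a.1 p.2.2 - p.2.1).toNat, p.2.2)
  else (p.2.2, (a.1 p.2.2 - a.1 p.1 + p.2.1).toNat, p.1)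

lemma OffDiag.exchange_spec {a : MSeq} {p : ℕ × ℕ × ℕ} (hp : OffDiag a p) :
    OffDiag a (exchange a p) ∧ exchange a (exchange a p) = p ∧
      uSeq (moveM a (exchange a p).1 (exchange a p).2.1 (exchange a p).2.2) =
        -uSeq (moveM a p.1 p.2.1 p.2.2) := by
  obtain ⟨i, j, k⟩ := p
  obtain ⟨hik, ⟨hj, hlow⟩, hup⟩ := hp
  dsimp only at hik hj hlow hup
  by_cases hlt : (j : ℤ) < a.1 i - a.1 k
  · obtain ⟨j', hj'⟩ := Int.eq_ofNat_of_zero_le (show 0 ≤ a.1 i - a.1 k - j by omega)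
    have he : exchange a (i, j, k) = (i, j', k) := by
      simp only [exchange, if_pos hlt, hj']
      rfl
    have he' : exchange a (i, j', k) = (i, j, k) := by
      rw [exchange, if_pos (by dsimp only; omega)]
      dsimp only
      rw [show (a.1 i - a.1 k - j').toNat = j by omega]
    rw [he, he']
    refine ⟨⟨hik, ⟨by dsimp only; omega, fun l hl => hup l ?_⟩, fun l hl => hlow l ?_⟩,
      rfl, ?_⟩
    · dsimp only at hl
      omega
    · dsimp only at hl
      omega
    · dsimp only
      refine uSeq_swap hik ?_ ?_ fun m h1 h2 => ?_
      · rw [moveM_left _ _ hik, moveM_right _ _ hik]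
        omega
      · rw [moveM_left _ _ hik, moveM_right _ _ hik]
        omega
      · rw [moveM_of_ne _ _ h1 h2, moveM_of_ne _ _ h1 h2]
  · have hne := hlow k
    obtain ⟨j', hj'⟩ := Int.eq_ofNat_of_zero_le (show 0 ≤ a.1 k - a.1 i + j by omega)
    have he : exchange a (i, j, k) = (k, j', i) := by
      simp only [exchange, if_neg hlt, hj']
      rfl
    have he' : exchange a (k, j', i) = (i, j, k) := by
      rw [exchange, if_neg (by dsimp only; omega)]
      dsimp only
      rw [show (a.1 i - a.1 k + j').toNat = j by omega]
    rw [he, he']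
    refine ⟨⟨hik.symm, ⟨by dsimp only; omega, fun l hl => hlow l ?_⟩, fun l hl => hup l ?_⟩,
      rfl, ?_⟩
    · dsimp only at hl
      omega
    · dsimp only at hl
      omega
    · dsimp only
      refine uSeq_swap hik ?_ ?_ fun m h1 h2 => ?_
      · rw [moveM_right _ _ hik.symm, moveM_right _ _ hik]
        omega
      · rw [moveM_left _ _ hik.symm, moveM_left _ _ hik]
        omega
      · rw [moveM_of_ne _ _ h2 h1, moveM_of_ne _ _ h1 h2]

lemma sum_offDiag_eq_zero (a : MSeq) (T : Finset (ℕ × ℕ × ℕ)) (hT : ∀ p, p ∈ T ↔ OffDiag a p) :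
    ∑ p ∈ T, uSeq (moveM a p.1 p.2.1 p.2.2) = 0 := by
  refine Finset.sum_involution (fun p _ => exchange a p) (fun p hp => ?_) (fun p hp hne he => ?_)
    (fun p hp => ?_) fun p hp => ?_
  all_goals
    have h := ((hT p).1 hp).exchange_spec
  · rw [h.2.2, add_neg_cancel]
  · refine hne (eq_zero_of_eq_neg_self ?_)
    conv_lhs => rw [← he]
    exact h.2.2
  · exact (hT _).2 h.1
  · exact h.2.1

lemma exists_lowers_bound (a : MSeq) : ∃ K : ℕ, ∀ i j, Lowers a i j → i < K ∧ j < K ∧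
    ∀ k, K ≤ k → ∃ l, a.1 l = a.1 k + j := by
  obtain ⟨N, C, hC⟩ := a.exists_tail
  set J := ∑ i ∈ Finset.range N, (a.1 i - C + N).toNat with hJ
  refine ⟨N + J, fun i j h => ?_⟩
  have hi : i < N := by
    by_contra! hi
    exact h.2 (i + j) (by rw [hC _ (by omega), hC i hi]; push_cast; ring)
  have hj : (j : ℤ) < a.1 i - C + N := by
    by_contra! hj
    exact h.2 (C - a.1 i + j).toNat (by rw [hC _ (by omega)]; omega)
  have hle : (a.1 i - C + N).toNat ≤ J :=
    Finset.single_le_sum (f := fun i => (a.1 i - C + N).toNat) (fun _ _ => Nat.zero_le _)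
      (Finset.mem_range.2 hi)
  refine ⟨by omega, by omega, fun k hk => ⟨k - j, ?_⟩⟩
  rw [hC k (by omega), hC _ (by omega)]
  omega

/-- The Euler identity `Σ_j p_j p_j^⊥ = deg` puts every non-vacuum `u_a` in the span. -/
lemma uSeq_mem_sumSpan_of_lowers {a : MSeq} {i₀ j₀ : ℕ} (h₀ : Lowers a i₀ j₀) :
    uSeq a ∈ sumSpan := by
  obtain ⟨K, hK⟩ := exists_lowers_bound a
  set B := (Finset.range K ×ˢ Finset.range K).filter fun p => Lowers a p.1 p.2 with hB
  have memB : ∀ p, p ∈ B ↔ Lowers a p.1 p.2 := fun p => by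
    simp only [hB, Finset.mem_filter, Finset.mem_product, Finset.mem_range, and_iff_right_iff_imp]
    exact fun h => ⟨(hK _ _ h).1, (hK _ _ h).2.1⟩
  set T := (Finset.range K ×ˢ Finset.range K ×ˢ Finset.range K).filter (OffDiag a) with hT
  have memT : ∀ p, p ∈ T ↔ OffDiag a p := fun p => by
    simp only [hT, Finset.mem_filter, Finset.mem_product, Finset.mem_range, and_iff_right_iff_imp]
    intro h
    have h' := hK _ _ h.2.1
    refine ⟨h'.1, h'.2.1, ?_⟩
    by_contra! hk
    obtain ⟨l, hl⟩ := h'.2.2 _ hk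
    exact h.2.2 l hl
  have hmem : ∀ p ∈ B, ∑ k ∈ Finset.range K, uSeq (moveM a p.1 p.2 k) ∈ sumSpan := by
    intro p hp
    have hp := (memB p).1 hp
    refine Submodule.subset_span ⟨addAtM a p.1 (-(p.2 : ℤ)), p.2, hp.1, ?_⟩
    refine (finsum_eq_sum_of_support_subset _ fun k hk => ?_).symm
    by_contra hk'
    simp only [Finset.coe_range, Set.mem_Iio, not_lt] at hk'
    obtain ⟨l, hl⟩ := (hK _ _ hp).2.2 k hk'
    exact hk (uSeq_moveM_eq_zero hp ((hK _ _ hp).1.trans_le hk').ne hl)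
  have hoff : ∑ p ∈ B, ∑ k ∈ (Finset.range K).erase p.1, uSeq (moveM a p.1 p.2 k) = 0 := by
    rw [← sum_offDiag_eq_zero a T memT, Finset.sum_sigma']
    symm
    refine Finset.sum_bij_ne_zero (fun p _ _ => ⟨(p.1, p.2.1), p.2.2⟩) ?_ ?_ ?_ ?_
    · intro p hp _
      have h := (memT p).1 hp
      simp only [hT, Finset.mem_filter, Finset.mem_product, Finset.mem_range] at hp
      simp only [Finset.mem_sigma, memB, Finset.mem_erase, Finset.mem_range]
      exact ⟨h.2.1, h.1.symm, hp.1.2.2⟩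
    · rintro ⟨i, j, k⟩ _ _ ⟨i', j', k'⟩ _ _ h
      simpa [and_assoc] using h
    · rintro ⟨⟨i, j⟩, k⟩ hp hne
      simp only [Finset.mem_sigma, memB, Finset.mem_erase, Finset.mem_range] at hp
      refine ⟨(i, j, k), (memT _).2 ⟨hp.2.1.symm, hp.1, fun l hl => hne ?_⟩, hne, rfl⟩
      exact uSeq_moveM_eq_zero hp.1 hp.2.1.symm hl
    · intro _ _ _
      rfl
  have hsum : ∑ p ∈ B, ∑ k ∈ Finset.range K, uSeq (moveM a p.1 p.2 k) =
      (B.card : ℚ) • uSeq a := by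
    have hsplit : ∀ p ∈ B, ∑ k ∈ Finset.range K, uSeq (moveM a p.1 p.2 k) =
        uSeq a + ∑ k ∈ (Finset.range K).erase p.1, uSeq (moveM a p.1 p.2 k) := fun p hp => by
      rw [← Finset.add_sum_erase _ _ (Finset.mem_range.2 (hK _ _ ((memB p).1 hp)).1),
        uSeq_moveM_self]
    rw [Finset.sum_congr rfl hsplit, Finset.sum_add_distrib, hoff, add_zero, Finset.sum_const,
      Nat.cast_smul_eq_nsmul]
  have hcard : (B.card : ℚ) ≠ 0 :=
    Nat.cast_ne_zero.2 (Finset.card_ne_zero_of_mem ((memB (i₀, j₀)).2 h₀))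
  exact (Submodule.smul_mem_iff _ hcard).1 (hsum ▸ Submodule.sum_mem _ hmem)

/-- An injective Maya sequence with downward closed set of values is a permuted vacuum. -/
lemma exists_uSeq_eq_smul_vac {a : MSeq} (hinj : Function.Injective a.1)
    (hlow : ∀ i j, ¬ Lowers a i j) : ∃ c : ℚ, uSeq a = c • uSeq vac := by
  obtain ⟨N, C, hC⟩ := a.exists_tail
  have hdown : ∀ i (z : ℤ), z ≤ a.1 i → ∃ l, a.1 l = z := by
    intro i z hz
    rcases hz.eq_or_lt with h | h
    · exact ⟨i, h.symm⟩
    have h' := hlow i (a.1 i - z).toNat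
    simp only [Lowers, not_and, not_forall, not_not] at h'
    obtain ⟨l, hl⟩ := h' (by omega)
    exact ⟨l, by omega⟩
  have hgt : ∀ i < N, C - N < a.1 i := by
    intro i hi
    by_contra! h
    have := hinj (a₁ := i) (a₂ := (C - a.1 i).toNat) (by rw [hC (C - a.1 i).toNat (by omega)]; omega)
    omega
  have hle : ∀ i < N, a.1 i ≤ C := by
    intro i hi
    by_contra! h
    have hsub : Finset.Ioc (C - N) (C + 1) ⊆ (Finset.range N).image a.1 := by
      intro z hz
      rw [Finset.mem_Ioc] at hz
      obtain ⟨l, hl⟩ := hdown i z (by omega)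
      refine Finset.mem_image.2 ⟨l, Finset.mem_range.2 ?_, hl⟩
      by_contra! hNl
      have := hC l hNl
      omega
    have hcard := (Finset.card_le_card hsub).trans Finset.card_image_le
    rw [Int.card_Ioc, Finset.card_range] at hcard
    omega
  let f : Fin N → Fin N := fun i => ⟨(C - a.1 i).toNat, by
    have := hgt i i.2; have := i.2; omega⟩
  have hf : Function.Injective f := by
    intro i k h
    have h1 := hle i i.2
    have h2 := hle k k.2
    have h3 : (C - a.1 i).toNat = (C - a.1 k).toNat := congrArg Fin.val h
    exact Fin.ext (hinj (by omega))
  let τ : Equiv.Perm (Fin N) := Equiv.ofBijective f (Finite.injective_iff_bijective.1 hf)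
  refine ⟨((Equiv.Perm.sign τ⁻¹ : ℤ) : ℚ), ?_⟩
  rw [← uSeq_perm]
  refine uSeq_congr C fun i => ?_
  simp only [permActM, permAct, inv_inv, vac]
  split_ifs with hi
  · have h1 := hle i hi
    change a.1 i = -(((C - a.1 i).toNat : ℕ) : ℤ) + C
    omega
  · rw [hC i (by omega)]
    ring

lemma uSeq_mem_sup (a : MSeq) : uSeq a ∈ Submodule.span ℚ {uSeq vac} ⊔ sumSpan := by
  by_cases hlow : ∃ i j, Lowers a i j
  · obtain ⟨i, j, h⟩ := hlow
    exact Submodule.mem_sup_right (uSeq_mem_sumSpan_of_lowers h)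
  push Not at hlow
  by_cases hinj : Function.Injective a.1
  · obtain ⟨c, hc⟩ := exists_uSeq_eq_smul_vac hinj hlow
    exact Submodule.mem_sup_left (Submodule.mem_span_singleton.2 ⟨c, hc.symm⟩)
  · simp only [Function.Injective, not_forall] at hinj
    obtain ⟨i, k, h, hne⟩ := hinj
    rw [uSeq_eq_zero hne h]
    exact Submodule.zero_mem _

lemma span_vac_sup_sumSpan : Submodule.span ℚ {uSeq vac} ⊔ sumSpan = ⊤ := by
  refine eq_top_iff.2 fun x _ => ?_
  obtain ⟨v, rfl⟩ := Submodule.Quotient.mk_surjective _ x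
  induction v using Finsupp.induction_linear with
  | zero => exact Submodule.zero_mem _
  | add v w hv hw => exact Submodule.add_mem _ (hv trivial) (hw trivial)
  | single α c =>
    obtain ⟨a, rfl⟩ : ∃ a : MSeq, a.toCl = α := Quotient.exists_rep α
    have h := Submodule.smul_mem _ c (uSeq_mem_sup a)
    rwa [uSeq.eq_1 a, ← Submodule.Quotient.mk_smul, Finsupp.smul_single, smul_eq_mul,
      mul_one] at h

/-- **Lemma 3.2 (2).** For every `α ∈ M` and `j ≥ 1` all but finitely many of the images
of the `u_{α+jε_i}` (`i ≥ 1`) vanish in `U`, so `Σ_{i≥1} u_{α+jε_i}` makes sense in `U`;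
and the quotient `U_1` of `U` by the span of all these sums is isomorphic to `ℚ`. -/
theorem U1_one_dimensional :
    (∀ (a : MSeq) (j : ℕ), 1 ≤ j →
      {i : ℕ | uCl (Quotient.mk mayaSetoid (addAtM a i (j : ℤ))) ≠ 0}.Finite) ∧
    Nonempty
      ((Usp ⧸ Submodule.span ℚ
        {v : Usp | ∃ (a : MSeq) (j : ℕ), 1 ≤ j ∧
          v = ∑ᶠ i : ℕ, uCl (Quotient.mk mayaSetoid (addAtM a i (j : ℤ)))}) ≃ₗ[ℚ] ℚ) := by
  refine ⟨fun a j hj => uSeq_addAtM_support_finite a hj, ?_⟩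
  change Nonempty ((Usp ⧸ sumSpan) ≃ₗ[ℚ] ℚ)
  refine ⟨LinearEquiv.ofBijective (sumSpan.liftQ vacCoeff sumSpan_le_ker_vacCoeff) ⟨?_, ?_⟩⟩
  · refine (injective_iff_map_eq_zero _).2 fun x hx => ?_
    obtain ⟨y, rfl⟩ := Submodule.Quotient.mk_surjective _ x
    have hy : y ∈ Submodule.span ℚ {uSeq vac} ⊔ sumSpan := span_vac_sup_sumSpan ▸ trivial
    obtain ⟨z, hz, w, hw, rfl⟩ := Submodule.mem_sup.1 hy
    obtain ⟨c, rfl⟩ := Submodule.mem_span_singleton.1 hz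
    have hx' : vacCoeff (c • uSeq vac + w) = 0 := hx
    rw [map_add, map_smul, vacCoeff_vac, LinearMap.mem_ker.1 (sumSpan_le_ker_vacCoeff hw),
      smul_eq_mul, mul_one, add_zero] at hx'
    rw [hx', zero_smul, zero_add]
    exact (Submodule.Quotient.mk_eq_zero _).2 hw
  · intro c
    refine ⟨Submodule.Quotient.mk (c • uSeq vac), ?_⟩
    change vacCoeff (c • uSeq vac) = c
    rw [map_smul, vacCoeff_vac, smul_eq_mul, mul_one]
end RSF
end
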